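/- arXiv:1710.04510 — 3 statements merged into one kernel-verified Lean document; each statement's English description precedes it below -/
import Mathlib

section
/- (Plemelj formula.) Let U_s be an admissible shear flow and let 0 < a₀ < a₁ < 1. Then there exist C > 0 and b̄ > 0 such that for all a ∈ [a₀, a₁] and all b ∈ (0, b̄], |Φ_inv(a + ib) − G(a)| ≤ C √b, where G(a) := 1/(a U_s'(0)) + PV ∫₀¹ g(u)/(u − a) du + iπ g(a) and g(a) := (1−a)² U_s''(U_s⁻¹(a)) / (U_s'(U_s⁻¹(a)))³. -/
open MeasureTheory Filter Set

noncomputable section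

/-- The source term `F(y) = 1 - U(y) + y U'(y)` of the eigenmode ODE. -/
def srcF (U : ℝ → ℝ) (y : ℝ) : ℝ := 1 - U y + y * deriv U y

/-- The displacement thickness `Δ_s = ∫₀^∞ (1 - U)`. -/
def deltaS (U : ℝ → ℝ) : ℝ := ∫ y in Ioi (0:ℝ), (1 - U y)

/-- An admissible shear flow: smooth, monotone, `U(0) = 0`, `U → 1`,
`U''(0) ≠ 0`, finitely many inflexion points, and the decay conditions of the paper. -/
structure AdmissibleShearFlow (U : ℝ → ℝ) : Prop where
  smooth : ContDiff ℝ (⊤ : ℕ∞) U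
  mem_Ico : ∀ y, 0 ≤ y → U y ∈ Ico (0:ℝ) 1
  zero_val : U 0 = 0
  deriv_pos : ∀ y, 0 ≤ y → 0 < deriv U y
  tendsto_one : Tendsto U atTop (nhds 1)
  snd_deriv_zero_ne : iteratedDeriv 2 U 0 ≠ 0
  finite_inflexions : {y : ℝ | 0 < y ∧ iteratedDeriv 2 U y = 0}.Finite
  integrable_defect : IntegrableOn (fun y => 1 - U y) (Ioi (0:ℝ))
  derivs_bounded : ∀ j : ℕ, 1 ≤ j → j ≤ 3 →
    ∃ M : ℝ, ∀ y, 0 ≤ y → |iteratedDeriv j U y| ≤ M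
  decay_ratio₁ : Tendsto (fun y => (1 - U y) ^ 2 / deriv U y) atTop (nhds 0)
  decay_ratio₂ : Tendsto (fun y => y * (1 - U y)) atTop (nhds 0)
  decay_ratio₃ : IntegrableOn
    (fun y => (1 - U y) ^ 2 * iteratedDeriv 2 U y / (deriv U y) ^ 2) (Ioi (0:ℝ))
  kappa_decay : ∃ κ : ℝ, 0 < κ ∧ κ < 1/2 ∧ ∃ yκ > (0:ℝ), ∃ cκ > (0:ℝ),
    ∀ y, yκ ≤ y →
      (1 - U y) ^ ((2:ℝ) - κ) * iteratedDeriv 2 U y ≤ -cκ * (deriv U y) ^ 3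

/-- `φ` is a smooth solution of the eigenmode problem
`(μ - U_s)φ' + U_s'φ - (i/k)φ''' = F`, `φ(0) = 0`, `φ'(0) = 1`, `φ' → 0`, `φ → L`. -/
def IsEigSolution (U : ℝ → ℝ) (μ : ℂ) (k : ℝ) (L : ℂ) (φ : ℝ → ℂ) : Prop :=
  ContDiff ℝ (⊤ : ℕ∞) φ ∧
  (∀ y, 0 ≤ y →
    (μ - (U y : ℂ)) * deriv φ y + ((deriv U y : ℝ) : ℂ) * φ y
      - Complex.I / (k : ℂ) * iteratedDeriv 3 φ y = (srcF U y : ℂ)) ∧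
  φ 0 = 0 ∧ deriv φ 0 = 1 ∧
  Tendsto (deriv φ) atTop (nhds 0) ∧
  Tendsto φ atTop (nhds L)

/-- Same problem without the prescribed limit at infinity. -/
def IsBLSolution (U : ℝ → ℝ) (μ : ℂ) (k : ℝ) (φ : ℝ → ℂ) : Prop :=
  ContDiff ℝ (⊤ : ℕ∞) φ ∧
  (∀ y, 0 ≤ y →
    (μ - (U y : ℂ)) * deriv φ y + ((deriv U y : ℝ) : ℂ) * φ y
      - Complex.I / (k : ℂ) * iteratedDeriv 3 φ y = (srcF U y : ℂ)) ∧
  φ 0 = 0 ∧ deriv φ 0 = 1 ∧ Tendsto (deriv φ) atTop (nhds 0)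

/-- Cauchy principal value `PV ∫₀¹ h(u)/(u - a) du`. -/
def pvIntegral (h : ℝ → ℝ) (a : ℝ) : ℝ :=
  limUnder (nhdsWithin (0:ℝ) (Ioi 0))
    (fun ε => ∫ u in Ioo (0:ℝ) 1 \ Ioo (a - ε) (a + ε), h u / (u - a))

/-- Inverse of the shear flow on `[0, ∞)`. -/
def shearInv (U : ℝ → ℝ) (u : ℝ) : ℝ := Function.invFunOn U (Ici 0) u

/-- `g(u) = (1-u)² U''(U⁻¹(u)) / (U'(U⁻¹(u)))³`. -/
def gfun (U : ℝ → ℝ) (u : ℝ) : ℝ :=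
  (1 - u) ^ 2 * iteratedDeriv 2 U (shearInv U u) / (deriv U (shearInv U u)) ^ 3

/-- `G(a) = 1/(a U'(0)) + PV ∫₀¹ g(u)/(u-a) du + iπ g(a)`. -/
def Gfun (U : ℝ → ℝ) (a : ℝ) : ℂ :=
  ((1 / (a * deriv U 0) + pvIntegral (gfun U) a : ℝ) : ℂ)
    + Complex.I * ((Real.pi * gfun U a : ℝ) : ℂ)

/-- Crossing abscissa `χ(y) = Re G(U(y))`. -/
def chiAbscissa (U : ℝ → ℝ) (y : ℝ) : ℝ := (Gfun U (U y)).re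

/-- `ξ(γ)`: number of zeros of `U''` in `(0,∞)` with `χ(yᵢ) = γ`. -/
def xiEq (U : ℝ → ℝ) (γ : ℝ) : ℕ :=
  {y : ℝ | 0 < y ∧ iteratedDeriv 2 U y = 0 ∧ chiAbscissa U y = γ}.ncard

/-- `ξ₊(γ)`: zeros of `U''` with `χ(yᵢ) < γ`, `U'' < 0` on the left and `U'' > 0`
on the right. -/
def xiPlus (U : ℝ → ℝ) (γ : ℝ) : ℕ :=
  {y : ℝ | 0 < y ∧ iteratedDeriv 2 U y = 0 ∧ chiAbscissa U y < γ ∧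
    ∃ δ > (0:ℝ), (∀ z ∈ Ioo (y - δ) y, iteratedDeriv 2 U z < 0) ∧
      (∀ z ∈ Ioo y (y + δ), 0 < iteratedDeriv 2 U z)}.ncard

/-- `ξ₋(γ)`: zeros of `U''` with `χ(yᵢ) < γ`, `U'' > 0` on the left and `U'' < 0`
on the right. -/
def xiMinus (U : ℝ → ℝ) (γ : ℝ) : ℕ :=
  {y : ℝ | 0 < y ∧ iteratedDeriv 2 U y = 0 ∧ chiAbscissa U y < γ ∧
    ∃ δ > (0:ℝ), (∀ z ∈ Ioo (y - δ) y, 0 < iteratedDeriv 2 U z) ∧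
      (∀ z ∈ Ioo y (y + δ), iteratedDeriv 2 U z < 0)}.ncard

/-- `Φ_inv(μ) = (μ - 1) ∫₀^∞ F(y)/(μ - U(y))² dy`. -/
def PhiInv (U : ℝ → ℝ) (μ : ℂ) : ℂ :=
  (μ - 1) * ∫ y in Ioi (0:ℝ), (srcF U y : ℂ) / (μ - (U y : ℂ)) ^ 2

/-- A weight function `ω ≥ 1` with `C_ω < ∞`. -/
structure WeightFn (ω : ℝ → ℝ) : Prop where
  pos : ∀ y, 0 ≤ y → 0 < ω y
  contDiff : ContDiff ℝ 1 ω
  one_le : ∀ y, 0 ≤ y → 1 ≤ ω y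
  integrable_inv : IntegrableOn (fun y => 1 / ω y) (Ioi (0:ℝ))
  deriv_ratio_bdd : ∃ M : ℝ, ∀ y, 0 ≤ y → |deriv ω y / ω y| ≤ M
  log_ratio_bdd : ∃ M : ℝ, ∀ y, 0 ≤ y → Real.log (ω y) / (1 + y) ≤ M

/-- Weighted decay conditions: `(1-U_s) ∈ L²(ω)` and `(1+y)U_s^{(j)} ∈ L²(ω)`, `j = 1,2,3`. -/
def WeightedDecay (U ω : ℝ → ℝ) : Prop :=
  IntegrableOn (fun y => (1 - U y) ^ 2 * ω y) (Ioi (0:ℝ)) ∧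
  ∀ j : ℕ, 1 ≤ j → j ≤ 3 →
    IntegrableOn (fun y => ((1 + y) * iteratedDeriv j U y) ^ 2 * ω y) (Ioi (0:ℝ))

/-- Membership in the weighted space `L²(ω)`. -/
def MemL2w (ω : ℝ → ℝ) (f : ℝ → ℂ) : Prop :=
  IntegrableOn (fun y => ‖f y‖ ^ 2 * ω y) (Ioi (0:ℝ))

/-- The `L²(ω)` norm. -/
def wNorm (ω : ℝ → ℝ) (f : ℝ → ℂ) : ℝ :=
  Real.sqrt (∫ y in Ioi (0:ℝ), ‖f y‖ ^ 2 * ω y)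

/-- `φ` solves the homogeneous-boundary-conditions resolvent problem with forcing `f`. -/
def SolvesHom (U : ℝ → ℝ) (μ : ℂ) (k : ℝ) (f φ : ℝ → ℂ) : Prop :=
  ContDiff ℝ 2 φ ∧
  (∀ᵐ y ∂(volume.restrict (Ioi (0:ℝ))),
    (μ - (U y : ℂ)) * deriv φ y + ((deriv U y : ℝ) : ℂ) * φ y
      - Complex.I / (k : ℂ) * iteratedDeriv 3 φ y = f y) ∧
  φ 0 = 0 ∧ deriv φ 0 = 0 ∧ Tendsto (deriv φ) atTop (nhds 0)

/-- Parameterization on `[0,1]` of the contour `C_η`: the segment from `iη` to `1 + iη`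
followed by the upper half-circle of radius `1/2` centered at `1/2 + iη`. -/
def Ceta (η : ℝ) (t : ℝ) : ℂ :=
  if t ≤ 1/2 then ((2*t : ℝ) : ℂ) + (η : ℂ) * Complex.I
  else (1/2 : ℂ) + (η : ℂ) * Complex.I
    + (1/2 : ℂ) * Complex.exp (((Real.pi * (2*t - 1) : ℝ)) * Complex.I)

/-- Winding number `(1/2πi) ∮ dz/(z - p)` of a closed curve parameterized on `[0,1]`. -/
def windingNumber (c : ℝ → ℂ) (p : ℂ) : ℂ :=
  (((2 * Real.pi : ℝ) : ℂ) * Complex.I)⁻¹ * ∫ t in (0:ℝ)..1, deriv c t / (c t - p)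

/-- `q_μ(x) = |μ - x|⁴ - (2μ - 1 - x)(μ̄ - x)²`. -/
def qmu (μ : ℂ) (x : ℝ) : ℂ :=
  ((‖μ - (x:ℂ)‖ ^ 4 : ℝ) : ℂ) - (2*μ - 1 - (x:ℂ)) * ((starRingEnd ℂ) μ - (x:ℂ))^2

/-- `f(α) = -2iΔ_s/α + 1/√α`, principal square root (positive real part for `Re α > 0`). -/
def fIBL (Δ : ℝ) (α : ℂ) : ℂ := (-2 * Complex.I * (Δ:ℂ)) / α + 1 / (α ^ (1/2 : ℂ))

namespace PlemeljAux

/-- The density `(1-U)² U''/(U')²`. -/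
def hfun (U : ℝ → ℝ) (y : ℝ) : ℝ := (1 - U y) ^ 2 * iteratedDeriv 2 U y / (deriv U y) ^ 2

theorem hasDeriv1 {U : ℝ → ℝ} (hU : AdmissibleShearFlow U) (y : ℝ) :
    HasDerivAt U (deriv U y) y :=
  (hU.smooth.differentiable (by simp)).differentiableAt.hasDerivAt

theorem hasDeriv2 {U : ℝ → ℝ} (hU : AdmissibleShearFlow U) (y : ℝ) :
    HasDerivAt (deriv U) (iteratedDeriv 2 U y) y := by
  have h : Differentiable ℝ (iteratedDeriv 1 U) :=
    hU.smooth.differentiable_iteratedDeriv 1 (by exact_mod_cast (ENat.natCast_lt_top 1))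
  rw [iteratedDeriv_one] at h
  rw [iteratedDeriv_succ, iteratedDeriv_one]
  exact h.differentiableAt.hasDerivAt

theorem sub_ne {μ : ℂ} (hμ : 0 < μ.im) (x : ℝ) : μ - (x : ℂ) ≠ 0 := by
  intro h
  have := congrArg Complex.im h
  simp at this
  linarith

theorem inv_bound {μ : ℂ} (hμ : 0 < μ.im) (x : ℝ) : ‖(μ - (x : ℂ))⁻¹‖ ≤ μ.im⁻¹ := by
  rw [norm_inv]
  apply inv_anti₀ hμ
  have := Complex.abs_im_le_norm (μ - (x : ℂ))
  simp at this
  exact (le_abs_self _).trans this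

theorem continuous_U {U : ℝ → ℝ} (hU : AdmissibleShearFlow U) : Continuous U :=
  hU.smooth.continuous

theorem continuous_U' {U : ℝ → ℝ} (hU : AdmissibleShearFlow U) : Continuous (deriv U) :=
  continuous_iff_continuousAt.2 fun y => (hasDeriv2 hU y).continuousAt

theorem integrable_srcF {U : ℝ → ℝ} (hU : AdmissibleShearFlow U) :
    IntegrableOn (srcF U) (Ioi (0:ℝ)) := by
  have hc : Continuous (fun y => 1 - U y) := continuous_const.sub (continuous_U hU)
  have h2 : IntegrableOn (fun y => y * deriv U y) (Ioi (0:ℝ)) := by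
    have hd : ∀ y : ℝ, HasDerivAt (fun y => (∫ t in (0:ℝ)..y, (1 - U t)) - y * (1 - U y))
        (y * deriv U y) y := by
      intro y
      have e1 := (hc.integral_hasStrictDerivAt 0 y).hasDerivAt
      have e2 := (hasDerivAt_id y).mul ((hasDeriv1 hU y).const_sub 1)
      refine (e1.sub e2).congr_deriv ?_
      simp only [id]
      ring
    refine integrableOn_Ioi_deriv_of_nonneg (hd 0).continuousAt.continuousWithinAt
      (fun y _ => hd y) (fun y hy => ?_)
      ((intervalIntegral_tendsto_integral_Ioi 0 hU.integrable_defect tendsto_id).sub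
        hU.decay_ratio₂)
    have hy : 0 < y := hy
    exact mul_nonneg hy.le (hU.deriv_pos y hy.le).le
  exact hU.integrable_defect.add h2

theorem phi_eq {U : ℝ → ℝ} (hU : AdmissibleShearFlow U) {μ : ℂ} (hμ : 0 < μ.im) :
    PhiInv U μ = 1 / (μ * ((deriv U 0 : ℝ) : ℂ))
      + ∫ y in Ioi (0:ℝ), (hfun U y : ℂ) / ((U y : ℂ) - μ) := by
  set P : ℝ → ℝ := fun y => y * (1 - U y) + (1 - U y) ^ 2 / deriv U y with hP
  set W : ℝ → ℂ := fun y => -((P y : ℂ) / (μ - (U y : ℂ))) with hW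
  have hcinv : Continuous (fun y => (μ - (U y : ℂ))⁻¹) :=
    (continuous_const.sub (Complex.continuous_ofReal.comp (continuous_U hU))).inv₀
      (fun y => sub_ne hμ _)
  have hmeas : AEStronglyMeasurable (fun y => (μ - (U y : ℂ))⁻¹) (volume.restrict (Ioi (0:ℝ))) :=
    hcinv.aestronglyMeasurable
  have i1 : IntegrableOn (fun y => (srcF U y : ℂ) / (μ - (U y : ℂ)) ^ 2) (Ioi (0:ℝ)) := by
    have := ((integrable_srcF hU).ofReal (𝕜 := ℂ)).bdd_mul (c := μ.im⁻¹ ^ 2) (hmeas.pow 2)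
      (ae_of_all _ fun y => by
        simp only [Pi.pow_apply, norm_pow]
        exact pow_le_pow_left₀ (norm_nonneg _) (inv_bound hμ _) 2)
    refine this.congr (ae_of_all _ fun y => ?_)
    simp [div_eq_mul_inv, mul_comm]
  have i2 : IntegrableOn (fun y => (hfun U y : ℂ) / (μ - (U y : ℂ))) (Ioi (0:ℝ)) := by
    have := (hU.decay_ratio₃.ofReal (𝕜 := ℂ)).bdd_mul (c := μ.im⁻¹) hmeas
      (ae_of_all _ fun y => inv_bound hμ _)
    refine this.congr (ae_of_all _ fun y => ?_)
    simp [div_eq_mul_inv, mul_comm, hfun]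
  have hd : ∀ y : ℝ, 0 ≤ y → HasDerivAt W
      ((μ - 1) * ((srcF U y : ℂ) / (μ - (U y : ℂ)) ^ 2)
        + (hfun U y : ℂ) / (μ - (U y : ℂ))) y := by
    intro y hy
    have hpos := hU.deriv_pos y hy
    have dU := hasDeriv1 hU y
    have dU2 := hasDeriv2 hU y
    have d1 := (hasDerivAt_id y).mul (dU.const_sub 1)
    have d2 := ((dU.const_sub 1).pow 2).div dU2 hpos.ne'
    have dP : HasDerivAt P (-(1 - U y) - y * deriv U y - hfun U y) y := by
      refine (d1.add d2).congr_deriv ?_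
      simp only [id, hfun, Pi.pow_apply]
      field_simp
      ring
    have dW := (dP.ofReal_comp.div (dU.ofReal_comp.const_sub μ) (sub_ne hμ _)).neg
    refine dW.congr_deriv ?_
    have hne := sub_ne hμ (U y)
    have hpc : ((deriv U y : ℝ) : ℂ) ≠ 0 := by exact_mod_cast hpos.ne'
    simp only [hP, hfun, srcF]
    push_cast
    field_simp
    ring
  have hlim : Tendsto W atTop (nhds 0) := by
    have t1 : Tendsto P atTop (nhds 0) := by
      simpa using hU.decay_ratio₂.add hU.decay_ratio₁
    have t2 : Tendsto (fun y => (P y : ℂ)) atTop (nhds 0) := by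
      exact_mod_cast (Complex.continuous_ofReal.tendsto 0).comp t1
    have t3 : Tendsto (fun y => μ - (U y : ℂ)) atTop (nhds (μ - ((1:ℝ) : ℂ))) :=
      ((Complex.continuous_ofReal.tendsto 1).comp hU.tendsto_one).const_sub μ
    have := (t2.div t3 (sub_ne hμ 1)).neg
    simpa using this
  have key := integral_Ioi_of_hasDerivAt_of_tendsto (hd 0 le_rfl).continuousAt.continuousWithinAt
    (fun y hy => hd y (le_of_lt hy)) ((i1.const_mul (μ - 1)).add i2) hlim
  rw [integral_add (i1.const_mul (μ - 1)) i2, integral_const_mul] at key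
  have e : ∫ y in Ioi (0:ℝ), (hfun U y : ℂ) / ((U y : ℂ) - μ)
      = - ∫ y in Ioi (0:ℝ), (hfun U y : ℂ) / (μ - (U y : ℂ)) := by
    rw [← integral_neg]
    congr 1
    ext y
    rw [← div_neg, neg_sub]
  have e0 : W 0 = -(1 / (μ * ((deriv U 0 : ℝ) : ℂ))) := by
    simp [hW, hP, hU.zero_val, div_eq_mul_inv]
  rw [e0] at key
  rw [e, PhiInv]
  linear_combination key

theorem strictMono_U {U : ℝ → ℝ} (hU : AdmissibleShearFlow U) : StrictMonoOn U (Ici (0:ℝ)) :=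
  strictMonoOn_of_deriv_pos (convex_Ici 0) (continuous_U hU).continuousOn
    (fun y hy => hU.deriv_pos y (by rw [interior_Ici] at hy; exact le_of_lt hy))

theorem shearInv_U {U : ℝ → ℝ} (hU : AdmissibleShearFlow U) {y : ℝ} (hy : 0 ≤ y) :
    shearInv U (U y) = y :=
  (strictMono_U hU).injOn.leftInvOn_invFunOn hy

theorem exists_preimage {U : ℝ → ℝ} (hU : AdmissibleShearFlow U) {u : ℝ} (h0 : 0 < u)
    (h1 : u < 1) : ∃ y, 0 < y ∧ U y = u := by
  obtain ⟨Y, hY1, hY0⟩ := ((hU.tendsto_one.eventually_const_lt h1).and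
    (eventually_ge_atTop (0:ℝ))).exists
  obtain ⟨y, hy, rfl⟩ := intermediate_value_Icc hY0 (continuous_U hU).continuousOn
    (show u ∈ Icc (U 0) (U Y) from ⟨by rw [hU.zero_val]; exact h0.le, hY1.le⟩)
  refine ⟨y, lt_of_le_of_ne hy.1 ?_, rfl⟩
  rintro rfl
  rw [hU.zero_val] at h0
  exact lt_irrefl _ h0

theorem image_U {U : ℝ → ℝ} (hU : AdmissibleShearFlow U) : U '' Ioi 0 = Ioo 0 1 := by
  ext u
  constructor
  · rintro ⟨y, hy, rfl⟩
    have hy : 0 < y := hy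
    refine ⟨?_, (hU.mem_Ico y hy.le).2⟩
    have := strictMono_U hU (mem_Ici.2 le_rfl) (mem_Ici.2 hy.le) hy
    rwa [hU.zero_val] at this
  · rintro ⟨h0, h1⟩
    obtain ⟨y, hy, e⟩ := exists_preimage hU h0 h1
    exact ⟨y, hy, e⟩

theorem deriv_mul_gfun {U : ℝ → ℝ} (hU : AdmissibleShearFlow U) {y : ℝ} (hy : 0 ≤ y) :
    |deriv U y| * gfun U (U y) = hfun U y := by
  have hpos := hU.deriv_pos y hy
  rw [abs_of_pos hpos, gfun, shearInv_U hU hy, hfun]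
  field_simp

theorem injOn_U {U : ℝ → ℝ} (hU : AdmissibleShearFlow U) : InjOn U (Ioi (0:ℝ)) :=
  (strictMono_U hU).injOn.mono Ioi_subset_Ici_self

theorem integrable_gfun {U : ℝ → ℝ} (hU : AdmissibleShearFlow U) :
    IntegrableOn (gfun U) (Ioo (0:ℝ) 1) := by
  rw [← image_U hU, integrableOn_image_iff_integrableOn_abs_deriv_smul measurableSet_Ioi
    (fun y _ => (hasDeriv1 hU y).hasDerivWithinAt) (injOn_U hU)]
  refine (integrableOn_congr_fun (fun y hy => ?_) measurableSet_Ioi).2 hU.decay_ratio₃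
  exact deriv_mul_gfun hU (le_of_lt hy)

theorem change_var {U : ℝ → ℝ} (hU : AdmissibleShearFlow U) (μ : ℂ) :
    ∫ y in Ioi (0:ℝ), (hfun U y : ℂ) / ((U y : ℂ) - μ)
      = ∫ u in Ioo (0:ℝ) 1, (gfun U u : ℂ) / ((u : ℂ) - μ) := by
  rw [← image_U hU, integral_image_eq_integral_abs_deriv_smul measurableSet_Ioi
    (fun y _ => (hasDeriv1 hU y).hasDerivWithinAt) (injOn_U hU)]
  refine setIntegral_congr_fun measurableSet_Ioi (fun y hy => ?_)
  rw [← deriv_mul_gfun hU (le_of_lt hy), Complex.real_smul]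
  push_cast
  ring

theorem gfun_bounds {U : ℝ → ℝ} (hU : AdmissibleShearFlow U) {c : ℝ} (hc0 : 0 < c) (hc1 : c < 1) :
    ∃ L M : ℝ, 0 ≤ L ∧ 0 ≤ M ∧ (∀ u ∈ Ioc 0 c, |gfun U u| ≤ M) ∧
      ∀ u ∈ Ioc 0 c, ∀ v ∈ Ioc 0 c, |gfun U u - gfun U v| ≤ L * |u - v| := by
  obtain ⟨Y, hY, hUY⟩ := exists_preimage hU hc0 hc1
  set k : ℝ → ℝ := fun y => (1 - U y) ^ 2 * iteratedDeriv 2 U y / (deriv U y) ^ 3 with hk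
  have hC1 : ContDiff ℝ 1 U := hU.smooth.of_le (by exact_mod_cast le_top)
  have hC2 : ContDiff ℝ 1 (deriv U) := by
    have := hU.smooth.iterate_deriv 1
    exact ContDiff.of_le this (by exact_mod_cast le_top)
  have hC3 : ContDiff ℝ 1 (iteratedDeriv 2 U) := by
    have := hU.smooth.iterate_deriv 2
    rw [iteratedDeriv_eq_iterate]
    exact ContDiff.of_le this (by exact_mod_cast le_top)
  have hkC : ContDiffOn ℝ 1 k (Icc 0 Y) :=
    (((contDiff_const.sub hC1).pow 2).mul hC3).contDiffOn.div (hC2.pow 3).contDiffOn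
      (fun y hy => pow_ne_zero _ (hU.deriv_pos y hy.1).ne')
  obtain ⟨K, hK⟩ := hkC.exists_lipschitzOnWith one_ne_zero (convex_Icc 0 Y) isCompact_Icc
  obtain ⟨M, hM⟩ := isCompact_Icc.exists_bound_of_continuousOn hkC.continuousOn
  obtain ⟨z, hz, hzm⟩ := isCompact_Icc.exists_isMinOn (nonempty_Icc.2 hY.le)
    (continuous_U' hU).continuousOn
  have hm := hU.deriv_pos z hz.1
  have hpre : ∀ u ∈ Ioc 0 c, ∃ y ∈ Icc 0 Y, U y = u := by
    intro u hu
    obtain ⟨y, hy, e⟩ := exists_preimage hU hu.1 (hu.2.trans_lt hc1)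
    refine ⟨y, ⟨hy.le, ?_⟩, e⟩
    rw [← (strictMono_U hU).le_iff_le (mem_Ici.2 hy.le) (mem_Ici.2 hY.le), e, hUY]
    exact hu.2
  have hgk : ∀ y ∈ Icc 0 Y, gfun U (U y) = k y := by
    intro y hy
    rw [gfun, shearInv_U hU hy.1]
  have hM0 : 0 ≤ M := (norm_nonneg _).trans (hM 0 ⟨le_rfl, hY.le⟩)
  have hexp : ∀ x ∈ Icc 0 Y, ∀ y ∈ Icc 0 Y, x ≤ y → deriv U z * (y - x) ≤ U y - U x := by
    intro x hx y hy hxy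
    refine (convex_Icc 0 Y).mul_sub_le_image_sub_of_le_deriv (continuous_U hU).continuousOn
      (hC1.differentiable one_ne_zero).differentiableOn (fun w hw => ?_) x hx y hy hxy
    exact hzm (interior_subset hw)
  have hexp' : ∀ x ∈ Icc 0 Y, ∀ y ∈ Icc 0 Y, deriv U z * |x - y| ≤ |U x - U y| := by
    intro x hx y hy
    rcases le_total x y with h | h
    · rw [abs_sub_comm x, abs_sub_comm (U x), abs_of_nonneg (sub_nonneg.2 h)]
      exact (hexp x hx y hy h).trans (le_abs_self _)
    · rw [abs_of_nonneg (sub_nonneg.2 h)]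
      exact (hexp y hy x hx h).trans (le_abs_self _)
  refine ⟨K / deriv U z, M, by positivity, hM0, ?_, ?_⟩
  · intro u hu
    obtain ⟨y, hy, rfl⟩ := hpre u hu
    rw [hgk y hy]
    exact hM y hy
  · intro u hu v hv
    obtain ⟨x, hx, rfl⟩ := hpre u hu
    obtain ⟨y, hy, rfl⟩ := hpre v hv
    rw [hgk x hx, hgk y hy]
    have l1 := hK.dist_le_mul x hx y hy
    rw [Real.dist_eq, Real.dist_eq] at l1
    have l2 := hexp' x hx y hy
    calc |k x - k y| ≤ K * |x - y| := l1
      _ = K / deriv U z * (deriv U z * |x - y|) := by field_simp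
      _ ≤ _ := mul_le_mul_of_nonneg_left l2 (by positivity)

theorem odd_integral_zero (a : ℝ) (s : Set ℝ) (hs : MeasurableSet s)
    (hsym : ∀ u, 2 * a - u ∈ s ↔ u ∈ s) (f : ℝ → ℝ) (hf : ∀ u, f (2 * a - u) = - f u) :
    ∫ u in s, f u = 0 := by
  rw [← integral_indicator hs]
  have h := integral_sub_left_eq_self (s.indicator f) volume (2 * a)
  have h2 : (fun u => s.indicator f (2 * a - u)) = fun u => - s.indicator f u := by
    ext u
    by_cases hu : u ∈ s
    · rw [indicator_of_mem hu, indicator_of_mem ((hsym u).2 hu), hf]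
    · rw [indicator_of_notMem hu, indicator_of_notMem (fun h => hu ((hsym u).1 h)), neg_zero]
  rw [h2, integral_neg] at h
  linarith

theorem mem_Ioo_sym (a d u : ℝ) : 2 * a - u ∈ Ioo (a - d) (a + d) ↔ u ∈ Ioo (a - d) (a + d) := by
  constructor <;> rintro ⟨h1, h2⟩ <;> constructor <;> linarith

theorem arctan_integral (a : ℝ) {b d : ℝ} (hb : 0 < b) (hd : 0 < d) :
    ∫ u in Ioo (a - d) (a + d), b / ((u - a) ^ 2 + b ^ 2) = 2 * Real.arctan (d / b) := by
  rw [← integral_Ioc_eq_integral_Ioo, ← intervalIntegral.integral_of_le (by linarith)]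
  have hder : ∀ u : ℝ, HasDerivAt (fun u => Real.arctan ((u - a) / b))
      (b / ((u - a) ^ 2 + b ^ 2)) u := by
    intro u
    have := ((((hasDerivAt_id u).sub_const a).div_const b)).arctan
    refine this.congr_deriv ?_
    simp only [id]
    have : (u - a) ^ 2 + b ^ 2 ≠ 0 := by positivity
    have : 1 + ((u - a) / b) ^ 2 ≠ 0 := by positivity
    field_simp
    ring
  rw [intervalIntegral.integral_eq_sub_of_hasDerivAt (fun u _ => hder u)]
  · have e1 : (a + d - a) / b = d / b := by ring
    have e2 : (a - d - a) / b = -(d / b) := by ring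
    simp only [e1, e2, Real.arctan_neg]
    ring
  · apply Continuous.intervalIntegrable
    exact continuous_const.div (by fun_prop) (fun u => by positivity)

theorem inv_formula (a b u : ℝ) (hb : 0 < b) :
    ((u : ℂ) - (a + b * Complex.I))⁻¹
      = (((u - a) / ((u - a) ^ 2 + b ^ 2) : ℝ) : ℂ)
        + ((b / ((u - a) ^ 2 + b ^ 2) : ℝ) : ℂ) * Complex.I := by
  have h1 : (u - a) ^ 2 + b ^ 2 ≠ 0 := by positivity
  have h2 : ((u : ℂ) - a) ^ 2 + b ^ 2 ≠ 0 := by exact_mod_cast h1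
  refine inv_eq_of_mul_eq_one_right ?_
  push_cast
  field_simp
  linear_combination (-(b:ℂ)^2) * Complex.I_sq

theorem inv_integral (a : ℝ) {b d : ℝ} (hb : 0 < b) (hd : 0 < d) :
    ∫ u in Ioo (a - d) (a + d), ((u : ℂ) - (a + b * Complex.I))⁻¹
      = ((2 * Real.arctan (d / b) : ℝ) : ℂ) * Complex.I := by
  simp only [inv_formula a b _ hb]
  have i1 : IntegrableOn (fun u => (u - a) / ((u - a) ^ 2 + b ^ 2)) (Ioo (a - d) (a + d)) := by
    apply (Continuous.integrableOn_Icc _).mono_set Ioo_subset_Icc_self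
    exact Continuous.div (by fun_prop) (by fun_prop) (fun u => by positivity)
  have i2 : IntegrableOn (fun u => b / ((u - a) ^ 2 + b ^ 2)) (Ioo (a - d) (a + d)) := by
    apply (Continuous.integrableOn_Icc _).mono_set Ioo_subset_Icc_self
    exact Continuous.div (by fun_prop) (by fun_prop) (fun u => by positivity)
  rw [integral_add i1.ofReal (i2.ofReal.mul_const _), integral_mul_const]
  rw [integral_complex_ofReal, integral_complex_ofReal, arctan_integral a hb hd,
    odd_integral_zero a _ measurableSet_Ioo (mem_Ioo_sym a d)]
  · simp
  · intro u
    rw [← neg_div]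
    congr 1 <;> ring

theorem q_integrable {g : ℝ → ℝ} {a d L : ℝ} (h0 : 0 < a - d) (h1 : a + d < 1)
    (hg : IntegrableOn g (Ioo 0 1)) 
    (hL : ∀ u ∈ Ioo (a - d) (a + d), |g u - g a| ≤ L * |u - a|) (hL0 : 0 ≤ L) :
    (∀ u ∈ Ioo (a - d) (a + d), ‖(g u - g a) / (u - a)‖ ≤ L) ∧
    IntegrableOn (fun u => (g u - g a) / (u - a)) (Ioo (a - d) (a + d)) := by
  have hb : ∀ u ∈ Ioo (a - d) (a + d), ‖(g u - g a) / (u - a)‖ ≤ L := by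
    intro u hu
    rw [Real.norm_eq_abs, abs_div]
    rcases eq_or_ne u a with rfl | hne
    · simpa using hL0
    · rw [div_le_iff₀ (abs_pos.2 (sub_ne_zero.2 hne))]
      exact hL u hu
  refine ⟨hb, ?_⟩
  have hgB : IntegrableOn g (Ioo (a - d) (a + d)) := hg.mono_set (Ioo_subset_Ioo h0.le h1.le)
  refine Integrable.of_bound ?_ L
    (ae_restrict_of_forall_mem measurableSet_Ioo hb)
  simp only [div_eq_mul_inv]
  exact (hgB.aestronglyMeasurable.sub aestronglyMeasurable_const).mul
    (by fun_prop : Measurable fun u : ℝ => (u - a)⁻¹).aestronglyMeasurable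

theorem O_bound {a d u : ℝ} (hu : u ∉ Ioo (a - d) (a + d)) : d ≤ |u - a| := by
  by_contra h
  push Not at h
  rw [abs_lt] at h
  exact hu ⟨by linarith, by linarith⟩

theorem O_integrable {g : ℝ → ℝ} {a d : ℝ} (hd : 0 < d) {s : Set ℝ} (hs : MeasurableSet s)
    (hg : IntegrableOn g s) :
    IntegrableOn (fun u => g u / (u - a)) (s \ Ioo (a - d) (a + d)) := by
  have := (hg.mono_set (sdiff_subset (t := Ioo (a - d) (a + d)))).bdd_mul (c := d⁻¹)
    (f := fun u => (u - a)⁻¹)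
    (by fun_prop : Measurable fun u : ℝ => (u - a)⁻¹).aestronglyMeasurable
    (ae_restrict_of_forall_mem (hs.diff measurableSet_Ioo) fun u hu => by
      rw [norm_inv, Real.norm_eq_abs]
      exact inv_anti₀ hd (O_bound hu.2))
  refine this.congr (ae_of_all _ fun u => ?_)
  simp [div_eq_mul_inv, mul_comm]

theorem pv_eq {g : ℝ → ℝ} {a d L : ℝ} (hd : 0 < d) (h0 : 0 < a - d) (h1 : a + d < 1)
    (hg : IntegrableOn g (Ioo 0 1))
    (hL : ∀ u ∈ Ioo (a - d) (a + d), |g u - g a| ≤ L * |u - a|) (hL0 : 0 ≤ L) :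
    pvIntegral g a = (∫ u in Ioo (0:ℝ) 1 \ Ioo (a - d) (a + d), g u / (u - a))
      + ∫ u in Ioo (a - d) (a + d), (g u - g a) / (u - a) := by
  obtain ⟨hqb, hq⟩ := q_integrable h0 h1 hg hL hL0
  have hBS : Ioo (a - d) (a + d) ⊆ Ioo 0 1 := Ioo_subset_Ioo h0.le h1.le
  have hgB : IntegrableOn g (Ioo (a - d) (a + d)) := hg.mono_set hBS
  set q : ℝ → ℝ := fun u => (g u - g a) / (u - a) with hqdef
  refine Tendsto.limUnder_eq ?_
  have hev : ∀ᶠ ε in nhdsWithin (0:ℝ) (Ioi 0),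
      (∫ u in Ioo (0:ℝ) 1 \ Ioo (a - d) (a + d), g u / (u - a))
        + ((∫ u in Ioo (a - d) (a + d), q u) - ∫ u in Ioo (a - ε) (a + ε), q u)
      = ∫ u in Ioo (0:ℝ) 1 \ Ioo (a - ε) (a + ε), g u / (u - a) := by
    filter_upwards [Ioo_mem_nhdsGT hd] with ε hε
    have hsub : Ioo (a - ε) (a + ε) ⊆ Ioo (a - d) (a + d) :=
      Ioo_subset_Ioo (by linarith [hε.2]) (by linarith [hε.2])
    have hset : Ioo (0:ℝ) 1 \ Ioo (a - ε) (a + ε) = (Ioo (0:ℝ) 1 \ Ioo (a - d) (a + d))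
        ∪ (Ioo (a - d) (a + d) \ Ioo (a - ε) (a + ε)) := by
      ext u
      have m1 := @hsub u
      have m2 := @hBS u
      simp only [mem_union, Set.mem_sdiff]
      tauto
    have hdisj : Disjoint (Ioo (0:ℝ) 1 \ Ioo (a - d) (a + d))
        (Ioo (a - d) (a + d) \ Ioo (a - ε) (a + ε)) :=
      disjoint_left.2 fun u hu hu' => hu.2 hu'.1
    have hm : MeasurableSet (Ioo (a - d) (a + d) \ Ioo (a - ε) (a + ε)) :=
      measurableSet_Ioo.diff measurableSet_Ioo
    rw [hset, setIntegral_union hdisj hm (O_integrable hd measurableSet_Ioo hg)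
      (O_integrable hε.1 measurableSet_Ioo hgB)]
    congr 1
    rw [← setIntegral_sdiff measurableSet_Ioo hq hsub]
    have i1 : IntegrableOn (fun u => g a / (u - a)) (Ioo (a - d) (a + d) \ Ioo (a - ε) (a + ε)) :=
      O_integrable (g := fun _ => g a) hε.1 measurableSet_Ioo
        (integrableOn_const (by simp))
    have z : ∫ u in Ioo (a - d) (a + d) \ Ioo (a - ε) (a + ε), g a / (u - a) = 0 := by
      refine odd_integral_zero a _ hm (fun u => ?_) _ (fun u => ?_)
      · rw [Set.mem_sdiff, Set.mem_sdiff, mem_Ioo_sym, mem_Ioo_sym]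
      · rw [← div_neg]
        congr 1
        ring
    rw [← add_zero (∫ u in Ioo (a - d) (a + d) \ Ioo (a - ε) (a + ε), q u), ← z,
      ← integral_add (hq.mono_set sdiff_subset) i1]
    congr 1
    ext u
    simp only [hqdef]
    ring
  refine Tendsto.congr' hev ?_
  have hz : Tendsto (fun ε => ∫ u in Ioo (a - ε) (a + ε), q u) (nhdsWithin (0:ℝ) (Ioi 0))
      (nhds 0) := by
    have hb : ∀ᶠ ε in nhdsWithin (0:ℝ) (Ioi 0),
        ‖∫ u in Ioo (a - ε) (a + ε), q u‖ ≤ L * (2 * ε) := by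
      filter_upwards [Ioo_mem_nhdsGT hd] with ε hε
      have hsub : Ioo (a - ε) (a + ε) ⊆ Ioo (a - d) (a + d) :=
        Ioo_subset_Ioo (by linarith [hε.2]) (by linarith [hε.2])
      have := norm_setIntegral_le_of_norm_le_const (μ := volume) (s := Ioo (a - ε) (a + ε))
        (f := q) (C := L) (by simp) (fun u hu => hqb u (hsub hu))
      rw [Real.volume_real_Ioo_of_le (by linarith [hε.1])] at this
      convert this using 2
      ring
    refine squeeze_zero_norm' hb ?_
    have : Tendsto (fun ε : ℝ => L * (2 * ε)) (nhds 0) (nhds (L * (2 * 0))) :=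
      (by fun_prop : Continuous fun ε : ℝ => L * (2 * ε)).tendsto 0
    simp only [mul_zero] at this
    exact this.mono_left nhdsWithin_le_nhds
  simpa using (tendsto_const_nhds.sub hz).const_add
    (∫ u in Ioo (0:ℝ) 1 \ Ioo (a - d) (a + d), g u / (u - a))

theorem norm_mu (a b u : ℝ) : ‖(u : ℂ) - (a + b * Complex.I)‖ ^ 2 = (u - a) ^ 2 + b ^ 2 := by
  rw [Complex.sq_norm, Complex.normSq_apply]
  simp
  ring

theorem inv_diff {a b u : ℝ} (hb : 0 < b) (hu : u ≠ a) :
    ‖((u : ℂ) - (a + b * Complex.I))⁻¹ - ((u - a : ℝ) : ℂ)⁻¹‖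
      = b / (|u - a| * ‖(u : ℂ) - (a + b * Complex.I)‖) := by
  have h1 : ((u - a : ℝ) : ℂ) ≠ 0 := by exact_mod_cast sub_ne_zero.2 hu
  have h2 : (u : ℂ) - (a + b * Complex.I) ≠ 0 := by
    intro h
    have := norm_mu a b u
    rw [h] at this
    simp at this
    nlinarith [sq_nonneg (u - a)]
  rw [inv_sub_inv h2 h1]
  have : ((u - a : ℝ) : ℂ) - ((u : ℂ) - (a + b * Complex.I)) = b * Complex.I := by
    push_cast; ring
  rw [this, norm_div, norm_mul, norm_mul, Complex.norm_I, Complex.norm_real, Complex.norm_real,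
    Real.norm_eq_abs, Real.norm_eq_abs, abs_of_pos hb, mul_one, mul_comm ‖_‖]

theorem plemelj_abs {g : ℝ → ℝ} {a b d L M : ℝ} (hb : 0 < b) (hb1 : b ≤ 1)
    (hd : 0 < d) (h0 : 0 < a - d) (h1 : a + d < 1)
    (hg : IntegrableOn g (Ioo 0 1))
    (hL : ∀ u ∈ Ioo (a - d) (a + d), |g u - g a| ≤ L * |u - a|) (hL0 : 0 ≤ L)
    (hM : |g a| ≤ M) :
    ‖(∫ u in Ioo (0:ℝ) 1, (g u : ℂ) / ((u : ℂ) - (a + b * Complex.I)))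
      - (((pvIntegral g a : ℝ) : ℂ) + Complex.I * ((Real.pi * g a : ℝ) : ℂ))‖
      ≤ ((∫ u in Ioo (0:ℝ) 1, |g u|) / d ^ 2 + L / 2 * (2 * d + Real.pi) + M * (2 / d))
        * Real.sqrt b := by
  obtain ⟨hqb, hq⟩ := q_integrable h0 h1 hg hL hL0
  have hBS : Ioo (a - d) (a + d) ⊆ Ioo 0 1 := Ioo_subset_Ioo h0.le h1.le
  have hgB : IntegrableOn g (Ioo (a - d) (a + d)) := hg.mono_set hBS
  have hgO : IntegrableOn g (Ioo 0 1 \ Ioo (a - d) (a + d)) := hg.mono_set sdiff_subset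
  set r : ℝ → ℂ := fun u => ((u : ℂ) - (a + b * Complex.I))⁻¹ with hr
  have hne : ∀ u : ℝ, (u : ℂ) - (a + b * Complex.I) ≠ 0 := by
    intro u h
    have := norm_mu a b u
    rw [h] at this
    simp at this
    nlinarith [sq_nonneg (u - a)]
  have hn : ∀ u : ℝ, b ≤ ‖(u : ℂ) - (a + b * Complex.I)‖ := by
    intro u
    refine le_of_sq_le_sq ?_ (norm_nonneg _)
    rw [norm_mu]
    nlinarith [sq_nonneg (u - a)]
  have hn' : ∀ u : ℝ, |u - a| ≤ ‖(u : ℂ) - (a + b * Complex.I)‖ := by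
    intro u
    refine le_of_sq_le_sq ?_ (norm_nonneg _)
    rw [norm_mu, sq_abs]
    nlinarith [sq_nonneg b]
  have hrc : Continuous r := Continuous.inv₀ (by fun_prop) hne
  have hrb : ∀ u, ‖r u‖ ≤ b⁻¹ := fun u => by
    rw [hr, norm_inv]
    exact inv_anti₀ hb (hn u)
  have hri : ∀ {f : ℝ → ℝ} {s : Set ℝ}, IntegrableOn f s →
      IntegrableOn (fun u => (f u : ℂ) * r u) s := by
    intro f s hf
    have := (hf.ofReal (𝕜 := ℂ)).bdd_mul (c := b⁻¹) (f := r) hrc.aestronglyMeasurable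
      (ae_of_all _ hrb)
    refine this.congr (ae_of_all _ fun u => ?_)
    simp [mul_comm]
  have hsb : 0 < Real.sqrt b := Real.sqrt_pos.2 hb
  have hbs : b ≤ Real.sqrt b := by
    rw [Real.le_sqrt' hb]
    nlinarith
  have hss : Real.sqrt b ^ 2 = b := Real.sq_sqrt hb.le
  have eS : (∫ u in Ioo (0:ℝ) 1, (g u : ℂ) / ((u : ℂ) - (a + b * Complex.I)))
      = (∫ u in Ioo (0:ℝ) 1 \ Ioo (a - d) (a + d), (g u : ℂ) * r u)
        + ((∫ u in Ioo (a - d) (a + d), ((g u - g a : ℝ) : ℂ) * r u)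
        + (g a : ℂ) * (((2 * Real.arctan (d / b) : ℝ) : ℂ) * Complex.I)) := by
    have e1 := setIntegral_sdiff (t := Ioo (a - d) (a + d)) measurableSet_Ioo (hri hg) hBS
    have hcB : IntegrableOn (fun _ : ℝ => g a) (Ioo (a - d) (a + d)) :=
      integrableOn_const (by simp)
    have e2 := integral_add (hri (hgB.sub hcB)) (hri hcB)
    rw [integral_const_mul, inv_integral a hb hd] at e2
    have e3 : ∫ u in Ioo (a - d) (a + d), (g u : ℂ) * r u
        = ∫ u in Ioo (a - d) (a + d), (((((g - (fun _ => g a) : ℝ → ℝ) u : ℝ)) : ℂ) * r u + (g a : ℂ) * r u) := by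
      congr 1
      ext u
      simp only [Pi.sub_apply]
      push_cast
      ring
    rw [e2] at e3
    simp only [Pi.sub_apply] at e3
    rw [e1, ← e3, sub_add_cancel]
    simp only [div_eq_mul_inv, hr]
  have eP : ((pvIntegral g a : ℝ) : ℂ)
      = (∫ u in Ioo (0:ℝ) 1 \ Ioo (a - d) (a + d), (g u : ℂ) * ((u - a : ℝ) : ℂ)⁻¹)
        + ∫ u in Ioo (a - d) (a + d), ((g u - g a : ℝ) : ℂ) * ((u - a : ℝ) : ℂ)⁻¹ := by
    rw [pv_eq hd h0 h1 hg hL hL0, Complex.ofReal_add, ← integral_complex_ofReal,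
      ← integral_complex_ofReal]
    simp only [Complex.ofReal_mul, Complex.ofReal_inv, div_eq_mul_inv]
  have iO : IntegrableOn (fun u => (g u : ℂ) * ((u - a : ℝ) : ℂ)⁻¹)
      (Ioo (0:ℝ) 1 \ Ioo (a - d) (a + d)) := by
    have := (O_integrable (a := a) hd measurableSet_Ioo hg).ofReal (𝕜 := ℂ)
    refine this.congr (ae_of_all _ fun u => ?_)
    simp [div_eq_mul_inv]
  have iB : IntegrableOn (fun u => ((g u - g a : ℝ) : ℂ) * ((u - a : ℝ) : ℂ)⁻¹)
      (Ioo (a - d) (a + d)) := by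
    refine (hq.ofReal (𝕜 := ℂ)).congr (ae_of_all _ fun u => ?_)
    simp [div_eq_mul_inv]
  have iBr : IntegrableOn (fun u => ((g u - g a : ℝ) : ℂ) * r u) (Ioo (a - d) (a + d)) :=
    hri (hgB.sub (integrableOn_const (by simp)))
  have b1 : ‖(∫ u in Ioo (0:ℝ) 1 \ Ioo (a - d) (a + d), (g u : ℂ) * r u)
      - ∫ u in Ioo (0:ℝ) 1 \ Ioo (a - d) (a + d), (g u : ℂ) * ((u - a : ℝ) : ℂ)⁻¹‖
      ≤ (∫ u in Ioo (0:ℝ) 1, |g u|) / d ^ 2 * Real.sqrt b := by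
    rw [← integral_sub (hri hgO) iO]
    have hgi : IntegrableOn (fun u => |g u| * (b / d ^ 2)) (Ioo (0:ℝ) 1) :=
      hg.abs.mul_const _
    refine (norm_integral_le_of_norm_le (hgi.mono_set sdiff_subset)
      (ae_restrict_of_forall_mem (measurableSet_Ioo.diff measurableSet_Ioo) fun u hu => ?_)).trans ?_
    · have hda := O_bound hu.2
      have hua : u ≠ a := by
        rintro rfl
        simp at hda
        linarith
      rw [← mul_sub, norm_mul, inv_diff hb hua, Complex.norm_real, Real.norm_eq_abs, sq]
      have := hda.trans (hn' u)
      gcongr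
    · refine (setIntegral_mono_set hgi (ae_of_all _ fun u => by positivity)
        sdiff_subset.eventuallyLE).trans ?_
      rw [integral_mul_const, mul_div_assoc', div_mul_eq_mul_div]
      have : 0 ≤ ∫ u in Ioo (0:ℝ) 1, |g u| := integral_nonneg fun u => abs_nonneg _
      gcongr
  have b2 : ‖(∫ u in Ioo (a - d) (a + d), ((g u - g a : ℝ) : ℂ) * r u)
      - ∫ u in Ioo (a - d) (a + d), ((g u - g a : ℝ) : ℂ) * ((u - a : ℝ) : ℂ)⁻¹‖
      ≤ L / 2 * (2 * d + Real.pi) * Real.sqrt b := by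
    rw [← integral_sub iBr iB]
    have i2 : IntegrableOn (fun u => b / ((u - a) ^ 2 + b ^ 2)) (Ioo (a - d) (a + d)) := by
      apply (Continuous.integrableOn_Icc _).mono_set Ioo_subset_Icc_self
      exact Continuous.div (by fun_prop) (by fun_prop) (fun u => by positivity)
    have i3 : IntegrableOn (fun _ : ℝ => (1:ℝ)) (Ioo (a - d) (a + d)) :=
      integrableOn_const (by simp)
    have i4 := (i3.add i2).const_mul (L / 2 * Real.sqrt b)
    refine (norm_integral_le_of_norm_le i4
      (ae_restrict_of_forall_mem measurableSet_Ioo fun u hu => ?_)).trans ?_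
    · rcases eq_or_ne u a with rfl | hua
      · simp
        positivity
      · rw [← mul_sub, norm_mul, inv_diff hb hua, Complex.norm_real, Real.norm_eq_abs]
        simp only [Pi.add_apply]
        rw [← norm_mu a b u]
        set n := ‖(u : ℂ) - (a + b * Complex.I)‖ with hnn
        have hnpos : 0 < n := hb.trans_le (hn u)
        have hs : 0 < |u - a| := abs_pos.2 (sub_ne_zero.2 hua)
        calc |g u - g a| * (b / (|u - a| * n)) ≤ (L * |u - a|) * (b / (|u - a| * n)) := by
              gcongr
              exact hL u hu
          _ = L * (b / n) := by field_simp
          _ ≤ L * (Real.sqrt b / 2 * (1 + b / n ^ 2)) := by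
              gcongr
              set t := Real.sqrt b with ht
              rw [← hss]
              have : t / 2 * (1 + t ^ 2 / n ^ 2) - t ^ 2 / n = t / 2 * (1 - t / n) ^ 2 := by
                field_simp
                ring
              have : 0 ≤ t / 2 * (1 - t / n) ^ 2 := by positivity
              linarith
          _ = _ := by ring
    · rw [integral_const_mul]
      simp only [Pi.add_apply]
      rw [integral_add i3 i2, arctan_integral a hb hd]
      have : ∫ _ in Ioo (a - d) (a + d), (1:ℝ) = 2 * d := by
        rw [setIntegral_const, Real.volume_real_Ioo_of_le (by linarith)]
        simp
        ring
      rw [this]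
      have hpi := Real.arctan_lt_pi_div_two (d / b)
      calc L / 2 * Real.sqrt b * (2 * d + 2 * Real.arctan (d / b))
          ≤ L / 2 * Real.sqrt b * (2 * d + Real.pi) := by
            gcongr
            linarith
        _ = _ := by ring
  have b3 : ‖(g a : ℂ) * (((2 * Real.arctan (d / b) : ℝ) : ℂ) * Complex.I)
      - Complex.I * ((Real.pi * g a : ℝ) : ℂ)‖ ≤ M * (2 / d) * Real.sqrt b := by
    have e : (g a : ℂ) * (((2 * Real.arctan (d / b) : ℝ) : ℂ) * Complex.I)
      - Complex.I * ((Real.pi * g a : ℝ) : ℂ)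
        = ((g a * (-(2 * Real.arctan (b / d))) : ℝ) : ℂ) * Complex.I := by
      have h := Real.arctan_inv_of_pos (x := d / b) (by positivity)
      rw [inv_div] at h
      rw [h]
      push_cast
      ring
    have hpos : 0 < Real.arctan (b / d) := Real.arctan_pos.2 (by positivity)
    have hle : Real.arctan (b / d) ≤ b / d := by
      have := Real.lt_tan hpos (Real.arctan_lt_pi_div_two _)
      rw [Real.tan_arctan] at this
      exact this.le
    rw [e, norm_mul, Complex.norm_I, mul_one, Complex.norm_real, Real.norm_eq_abs, abs_mul, abs_neg,
      abs_of_pos (by positivity : 0 < 2 * Real.arctan (b / d))]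
    have hM0 : 0 ≤ M := (abs_nonneg _).trans hM
    calc |g a| * (2 * Real.arctan (b / d)) ≤ M * (2 * (b / d)) := by gcongr
      _ = M * (2 / d) * b := by ring
      _ ≤ _ := by gcongr
  rw [eS, eP]
  refine le_trans (le_of_eq ?_) ((norm_add₃_le).trans (add_le_add_three b1 b2 b3)) |>.trans
    (le_of_eq (by ring))
  congr 1
  ring

end PlemeljAux

/-- Lemma (quantitative Plemelj formula, uniform on `[a₀, a₁]`). -/
theorem plemelj_formula (U : ℝ → ℝ) (hU : AdmissibleShearFlow U)
    (a₀ a₁ : ℝ) (h0 : 0 < a₀) (h01 : a₀ < a₁) (h1 : a₁ < 1) :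
    ∃ C : ℝ, 0 < C ∧ ∃ bbar : ℝ, 0 < bbar ∧
      ∀ a ∈ Icc a₀ a₁, ∀ b ∈ Ioc (0:ℝ) bbar,
        ‖PhiInv U ((a : ℂ) + (b : ℂ) * Complex.I) - Gfun U a‖ ≤ C * Real.sqrt b := by
  obtain ⟨d, hd, hd0, hd1⟩ : ∃ d : ℝ, 0 < d ∧ d < a₀ ∧ a₁ + d < 1 := by
    refine ⟨min a₀ (1 - a₁) / 2, ?_, ?_, ?_⟩
    · have : 0 < min a₀ (1 - a₁) := lt_min h0 (by linarith)
      linarith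
    · linarith [min_le_left a₀ (1 - a₁)]
    · linarith [min_le_right a₀ (1 - a₁)]
  obtain ⟨L, M, hL0, hM0, hM, hL⟩ := PlemeljAux.gfun_bounds hU (c := a₁ + d) (by linarith) hd1
  have hg := PlemeljAux.integrable_gfun hU
  have hU0 := hU.deriv_pos 0 le_rfl
  set N : ℝ := ∫ u in Ioo (0:ℝ) 1, |gfun U u| with hN
  have hN0 : 0 ≤ N := integral_nonneg fun u => abs_nonneg _
  have hpi := Real.pi_pos
  refine ⟨1 / (a₀ ^ 2 * deriv U 0)
    + (N / d ^ 2 + L / 2 * (2 * d + Real.pi) + M * (2 / d)), by positivity, 1, one_pos, ?_⟩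
  intro a ha b hb
  have hapos : 0 < a := h0.trans_le ha.1
  have hbs : b ≤ Real.sqrt b := by
    rw [Real.le_sqrt' hb.1]
    nlinarith [hb.1, hb.2]
  have hma : a ∈ Ioc 0 (a₁ + d) := ⟨hapos, by linarith [ha.2]⟩
  have key := PlemeljAux.plemelj_abs (g := gfun U) (a := a) (b := b) (d := d) (L := L) (M := M)
    hb.1 hb.2 hd (by linarith [ha.1]) (by linarith [ha.2]) hg
    (fun u hu => hL u ⟨by linarith [hu.1, ha.1], by linarith [hu.2, ha.2]⟩ a hma) hL0 (hM a hma)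
  have him : 0 < ((a : ℂ) + (b : ℂ) * Complex.I).im := by simpa using hb.1
  rw [PlemeljAux.phi_eq hU him, PlemeljAux.change_var hU]
  have hμ0 : (a : ℂ) + (b : ℂ) * Complex.I ≠ 0 := by
    intro h
    rw [h] at him
    simp at him
  have hμn : a ≤ ‖(a : ℂ) + (b : ℂ) * Complex.I‖ := by
    have := Complex.abs_re_le_norm ((a : ℂ) + (b : ℂ) * Complex.I)
    simp at this
    exact (le_abs_self _).trans this
  have first : ‖1 / (((a : ℂ) + (b : ℂ) * Complex.I) * ((deriv U 0 : ℝ) : ℂ))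
      - ((1 / (a * deriv U 0) : ℝ) : ℂ)‖ ≤ 1 / (a₀ ^ 2 * deriv U 0) * Real.sqrt b := by
    have hac : (a : ℂ) ≠ 0 := by exact_mod_cast hapos.ne'
    have hUc : ((deriv U 0 : ℝ) : ℂ) ≠ 0 := by exact_mod_cast hU0.ne'
    have e : 1 / (((a : ℂ) + (b : ℂ) * Complex.I) * ((deriv U 0 : ℝ) : ℂ))
      - ((1 / (a * deriv U 0) : ℝ) : ℂ) = -((b : ℂ) * Complex.I)
        / (((a : ℂ) + (b : ℂ) * Complex.I) * (a : ℂ) * ((deriv U 0 : ℝ) : ℂ)) := by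
      push_cast
      field_simp
      ring
    rw [e, norm_div, norm_neg, norm_mul, norm_mul, norm_mul, Complex.norm_I, Complex.norm_real,
      Complex.norm_real, Complex.norm_real, Real.norm_of_nonneg hb.1.le,
      Real.norm_of_nonneg hapos.le, Real.norm_of_nonneg hU0.le, mul_one, one_div_mul_eq_div, sq]
    have h1 := ha.1
    have h2 := ha.1.trans hμn
    gcongr
  rw [Gfun]
  refine le_trans (le_of_eq ?_) ((norm_add_le _ _).trans ((add_le_add first key).trans
    (le_of_eq (by rw [hN]; ring))))
  congr 1
  push_cast
  ring

end
end

section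
/- Let U_s be an admissible shear flow with decay exponent κ ∈ (0, 1/2). There exist positive constants c and ρ such that: (near 0) for all a ∈ [0, ρ] and b ∈ (0, ρ], either |Im Φ_inv(a + ib)| ≥ c or Re Φ_inv(a + ib) ≥ c/√b; moreover if in addition b² ≥ a(1−a), then Im Φ_inv(a + ib) ≤ −c; (near 1) for all a ∈ [1−ρ, 1] and b ∈ (0, ρ], Im Φ_inv(a + ib) ≤ −c b^κ. -/
open MeasureTheory Filter Set

noncomputable section

/-- The weight `h = (1-U)² U'' / U'²`. -/
def hker (U : ℝ → ℝ) (y : ℝ) : ℝ :=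
  (1 - U y) ^ 2 * iteratedDeriv 2 U y / (deriv U y) ^ 2

lemma AdmissibleShearFlow.hd {U : ℝ → ℝ} (hU : AdmissibleShearFlow U) (y : ℝ) :
    HasDerivAt U (deriv U y) y :=
  (hU.smooth.differentiable (by simp) y).hasDerivAt

lemma AdmissibleShearFlow.cont {U : ℝ → ℝ} (hU : AdmissibleShearFlow U) : Continuous U :=
  hU.smooth.continuous

lemma AdmissibleShearFlow.contd {U : ℝ → ℝ} (hU : AdmissibleShearFlow U) :
    Continuous (deriv U) :=
  hU.smooth.continuous_deriv (by simp)

lemma AdmissibleShearFlow.hd2 {U : ℝ → ℝ} (hU : AdmissibleShearFlow U) (y : ℝ) :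
    HasDerivAt (deriv U) (iteratedDeriv 2 U y) y := by
  have h := hU.smooth.differentiable_iteratedDeriv 1 (by norm_cast)
  rw [iteratedDeriv_one] at h
  have h2 := (h y).hasDerivAt
  rwa [← iteratedDeriv_one, ← iteratedDeriv_succ, iteratedDeriv_one] at h2

lemma AdmissibleShearFlow.contd2 {U : ℝ → ℝ} (hU : AdmissibleShearFlow U) :
    Continuous (iteratedDeriv 2 U) :=
  hU.smooth.continuous_iteratedDeriv 2 (by norm_cast)

lemma AdmissibleShearFlow.strictMono {U : ℝ → ℝ} (hU : AdmissibleShearFlow U) :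
    StrictMonoOn U (Ici 0) := by
  apply strictMonoOn_of_deriv_pos (convex_Ici 0) hU.cont.continuousOn
  intro x hx
  rw [interior_Ici] at hx
  exact hU.deriv_pos x (le_of_lt hx)

lemma AdmissibleShearFlow.integrable_srcF {U : ℝ → ℝ} (hU : AdmissibleShearFlow U) :
    IntegrableOn (srcF U) (Ioi 0) := by
  have hc : Continuous (fun y => 1 - U y) := continuous_const.sub hU.cont
  have h1 : ∀ x : ℝ, HasDerivAt (fun x => ∫ y in (0:ℝ)..x, (1 - U y)) (1 - U x) x :=
    fun x => intervalIntegral.integral_hasDerivAt_right (hc.intervalIntegrable _ _)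
      hc.stronglyMeasurable.stronglyMeasurableAtFilter hc.continuousAt
  have h2 := intervalIntegral_tendsto_integral_Ioi (0:ℝ) hU.integrable_defect tendsto_id
  apply integrableOn_Ioi_deriv_of_nonneg'
    (g := fun x => 2 * (∫ y in (0:ℝ)..x, (1 - U y)) - x * (1 - U x))
  · intro x _
    have := ((h1 x).const_mul 2).sub ((hasDerivAt_id x).mul ((hU.hd x).const_sub 1))
    refine this.congr_deriv ?_
    simp only [srcF, id]; ring
  · intro x hx
    have hx' : 0 ≤ x := le_of_lt hx
    have a1 := (hU.mem_Ico x hx').2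
    have a2 := mul_nonneg hx' (hU.deriv_pos x hx').le
    simp only [srcF]; linarith
  · exact (h2.const_mul 2).sub hU.decay_ratio₂

lemma mu_sub_ne {a b : ℝ} (hb : 0 < b) (u : ℝ) : (a : ℂ) + (b : ℂ) * Complex.I - (u : ℂ) ≠ 0 := by
  intro h
  have := congrArg Complex.im h
  simp at this
  exact hb.ne' this

lemma mu_sub_norm {a b : ℝ} (hb : 0 < b) (u : ℝ) :
    b ≤ ‖(a : ℂ) + (b : ℂ) * Complex.I - (u : ℂ)‖ := by
  have := Complex.abs_im_le_norm ((a : ℂ) + (b : ℂ) * Complex.I - (u : ℂ))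
  simp at this
  exact (le_abs_self b).trans this

lemma AdmissibleShearFlow.contInv {U : ℝ → ℝ} (hU : AdmissibleShearFlow U) {a b : ℝ}
    (hb : 0 < b) :
    Continuous (fun y : ℝ => ((a : ℂ) + (b : ℂ) * Complex.I - (U y : ℂ))⁻¹) := by
  apply Continuous.inv₀
  · have := hU.cont
    fun_prop
  · intro y; exact mu_sub_ne hb _

lemma AdmissibleShearFlow.integrable_src_div {U : ℝ → ℝ} (hU : AdmissibleShearFlow U) {a b : ℝ}
    (hb : 0 < b) :
    IntegrableOn (fun y : ℝ => (srcF U y : ℂ) / ((a : ℂ) + (b : ℂ) * Complex.I - (U y : ℂ)) ^ 2)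
      (Ioi 0) := by
  have h1 : IntegrableOn (fun y : ℝ => (srcF U y : ℂ)) (Ioi 0) := hU.integrable_srcF.ofReal
  have h2 := h1.bdd_mul (c := (b⁻¹) ^ 2) ((hU.contInv (a := a) hb).pow 2).aestronglyMeasurable
    (Eventually.of_forall (fun y => ?_))
  · refine h2.congr (Eventually.of_forall fun y => ?_)
    simp only [div_eq_mul_inv, inv_pow, mul_comm, Pi.pow_apply]
  · simp only [Pi.pow_apply]
    rw [norm_pow, norm_inv]
    gcongr
    exact mu_sub_norm hb _

lemma AdmissibleShearFlow.integrable_hker {U : ℝ → ℝ} (hU : AdmissibleShearFlow U) :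
    IntegrableOn (hker U) (Ioi 0) := hU.decay_ratio₃

lemma AdmissibleShearFlow.integrable_hker_div {U : ℝ → ℝ} (hU : AdmissibleShearFlow U) {a b : ℝ}
    (hb : 0 < b) :
    IntegrableOn (fun y : ℝ => -((hker U y : ℂ) / ((a : ℂ) + (b : ℂ) * Complex.I - (U y : ℂ))))
      (Ioi 0) := by
  have h1 : IntegrableOn (fun y : ℝ => (hker U y : ℂ)) (Ioi 0) := hU.integrable_hker.ofReal
  have h2 := h1.bdd_mul (c := (b⁻¹)) (hU.contInv (a := a) hb).aestronglyMeasurable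
    (Eventually.of_forall (fun y => ?_))
  · refine h2.neg.congr (Eventually.of_forall fun y => ?_)
    simp only [div_eq_mul_inv, mul_comm, Pi.neg_apply]
  · rw [norm_inv]
    gcongr
    exact mu_sub_norm hb _

lemma AdmissibleShearFlow.phi_eq {U : ℝ → ℝ} (hU : AdmissibleShearFlow U) {a b : ℝ}
    (hb : 0 < b) :
    PhiInv U ((a : ℂ) + (b : ℂ) * Complex.I) =
      1 / (((a : ℂ) + (b : ℂ) * Complex.I) * ((deriv U 0 : ℝ) : ℂ)) +
      ∫ y in Ioi (0:ℝ), -((hker U y : ℂ) / ((a : ℂ) + (b : ℂ) * Complex.I - (U y : ℂ))) := by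
  have hne : ∀ u : ℝ, (a : ℂ) + (b : ℂ) * Complex.I - (u : ℂ) ≠ 0 := mu_sub_ne hb
  have hnorm : ∀ u : ℝ, b ≤ ‖(a : ℂ) + (b : ℂ) * Complex.I - (u : ℂ)‖ := mu_sub_norm hb
  have i1 := hU.integrable_src_div (a := a) hb
  have i2 := hU.integrable_hker_div (a := a) hb
  set μ : ℂ := (a : ℂ) + (b : ℂ) * Complex.I with hμ
  have key : ∫ y in Ioi (0:ℝ), ((μ - 1) * ((srcF U y : ℂ) / (μ - (U y : ℂ)) ^ 2)
      - -((hker U y : ℂ) / (μ - (U y : ℂ)))) = 0 - (-(1 / (μ * ((deriv U 0 : ℝ) : ℂ)))) := by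
    have hW := integral_Ioi_of_hasDerivAt_of_tendsto' (a := (0:ℝ)) (m := (0:ℂ))
      (f := fun y : ℝ => (y : ℂ) * ((U y : ℂ) - 1) / (μ - (U y : ℂ))
        - (1 - (U y : ℂ)) ^ 2 / ((μ - (U y : ℂ)) * ((deriv U y : ℝ) : ℂ)))
      (f' := fun y : ℝ => ((μ - 1) * ((srcF U y : ℂ) / (μ - (U y : ℂ)) ^ 2)
      - -((hker U y : ℂ) / (μ - (U y : ℂ))))) ?_ ?_ ?_
    · rw [hW]
      simp [hU.zero_val]
    · intro y hy
      have hdp : ((deriv U y : ℝ) : ℂ) ≠ 0 := by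
        exact_mod_cast (hU.deriv_pos y hy).ne'
      have d1 : HasDerivAt (fun y : ℝ => (U y : ℂ)) ((deriv U y : ℝ) : ℂ) y := (hU.hd y).ofReal_comp
      have d2 : HasDerivAt (fun y : ℝ => ((deriv U y : ℝ) : ℂ)) ((iteratedDeriv 2 U y : ℝ) : ℂ) y :=
        (hU.hd2 y).ofReal_comp
      have d0 : HasDerivAt (fun y : ℝ => (y : ℂ)) 1 y := (hasDerivAt_id y).ofReal_comp
      have e1 := (d0.mul (d1.sub_const 1)).div (d1.const_sub μ) (hne (U y))
      have e2 := ((d1.const_sub 1).pow 2).div ((d1.const_sub μ).mul d2)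
        (mul_ne_zero (hne (U y)) hdp)
      refine (e1.sub e2).congr_deriv ?_
      have := hne (U y)
      simp only [srcF, hker, Pi.mul_apply, Pi.pow_apply]
      push_cast
      field_simp
      ring
    · exact (i1.const_mul (μ - 1)).sub i2
    · have t1 : Tendsto (fun y : ℝ => (y : ℂ) * ((U y : ℂ) - 1) / (μ - (U y : ℂ))) atTop
          (nhds 0) := by
        have := (hU.decay_ratio₂.abs).mul_const b⁻¹
        rw [abs_zero, zero_mul] at this
        refine squeeze_zero_norm (fun y => ?_) this
        have e : (y : ℂ) * ((U y : ℂ) - 1) = ((-(y * (1 - U y)) : ℝ) : ℂ) := by push_cast; ring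
        rw [e, norm_div, div_eq_mul_inv, Complex.norm_real, norm_neg, Real.norm_eq_abs]
        gcongr
        exact hnorm _
      have t2 : Tendsto (fun y : ℝ => (1 - (U y : ℂ)) ^ 2 / ((μ - (U y : ℂ)) * ((deriv U y : ℝ) : ℂ)))
          atTop (nhds 0) := by
        have := (hU.decay_ratio₁.abs).mul_const b⁻¹
        rw [abs_zero, zero_mul] at this
        refine squeeze_zero_norm (fun y => ?_) this
        have e : (1 - (U y : ℂ)) ^ 2 / ((μ - (U y : ℂ)) * ((deriv U y : ℝ) : ℂ))
          = (((1 - U y) ^ 2 / deriv U y : ℝ) : ℂ) * (μ - (U y : ℂ))⁻¹ := by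
          push_cast
          rw [mul_comm (μ - (U y : ℂ)), ← div_div, div_eq_mul_inv]
        rw [e, norm_mul, Complex.norm_real, norm_inv, Real.norm_eq_abs]
        gcongr
        exact hnorm _
      simpa using t1.sub t2
  rw [integral_sub (i1.const_mul (μ - 1)) i2, integral_const_mul] at key
  unfold PhiInv
  linear_combination key

lemma AdmissibleShearFlow.phi_im {U : ℝ → ℝ} (hU : AdmissibleShearFlow U) {a b : ℝ}
    (hb : 0 < b) :
    IntegrableOn (fun y => hker U y * (b / ((U y - a) ^ 2 + b ^ 2))) (Ioi 0) ∧
    (PhiInv U ((a : ℂ) + (b : ℂ) * Complex.I)).im =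
      -(b / ((a ^ 2 + b ^ 2) * deriv U 0)) +
      ∫ y in Ioi (0:ℝ), hker U y * (b / ((U y - a) ^ 2 + b ^ 2)) := by
  have i2 := hU.integrable_hker_div (a := a) hb
  have hd0 := (hU.deriv_pos 0 le_rfl).ne'
  have e : ∀ y, hker U y * (b / ((U y - a) ^ 2 + b ^ 2)) =
      RCLike.im (-((hker U y : ℂ) / ((a : ℂ) + (b : ℂ) * Complex.I - (U y : ℂ)))) := by
    intro y
    have : (U y - a) ^ 2 + b ^ 2 ≠ 0 := by positivity
    have : (a - U y) * (a - U y) + b * b ≠ 0 :=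
      (add_pos_of_nonneg_of_pos (mul_self_nonneg _) (mul_pos hb hb)).ne'
    simp [Complex.div_im, Complex.normSq_apply]
    field_simp
    ring
  simp_rw [e]
  refine ⟨i2.im, ?_⟩
  rw [hU.phi_eq hb, Complex.add_im, integral_im i2]
  congr 1
  have : a ^ 2 + b ^ 2 ≠ 0 := by positivity
  have : a * a + b * b ≠ 0 :=
    (add_pos_of_nonneg_of_pos (mul_self_nonneg _) (mul_pos hb hb)).ne'
  simp [Complex.normSq_apply]
  field_simp

lemma AdmissibleShearFlow.phi_re {U : ℝ → ℝ} (hU : AdmissibleShearFlow U) {a b : ℝ}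
    (hb : 0 < b) :
    IntegrableOn (fun y => hker U y * ((U y - a) / ((U y - a) ^ 2 + b ^ 2))) (Ioi 0) ∧
    (PhiInv U ((a : ℂ) + (b : ℂ) * Complex.I)).re =
      (a / ((a ^ 2 + b ^ 2) * deriv U 0)) +
      ∫ y in Ioi (0:ℝ), hker U y * ((U y - a) / ((U y - a) ^ 2 + b ^ 2)) := by
  have i2 := hU.integrable_hker_div (a := a) hb
  have hd0 := (hU.deriv_pos 0 le_rfl).ne'
  have e : ∀ y, hker U y * ((U y - a) / ((U y - a) ^ 2 + b ^ 2)) =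
      RCLike.re (-((hker U y : ℂ) / ((a : ℂ) + (b : ℂ) * Complex.I - (U y : ℂ)))) := by
    intro y
    have : (U y - a) ^ 2 + b ^ 2 ≠ 0 := by positivity
    have : (a - U y) * (a - U y) + b * b ≠ 0 :=
      (add_pos_of_nonneg_of_pos (mul_self_nonneg _) (mul_pos hb hb)).ne'
    simp [Complex.div_re, Complex.normSq_apply]
    field_simp
    ring
  simp_rw [e]
  refine ⟨i2.re, ?_⟩
  rw [hU.phi_eq hb, Complex.add_re, integral_re i2]
  congr 1
  have : a ^ 2 + b ^ 2 ≠ 0 := by positivity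
  have : a * a + b * b ≠ 0 :=
    (add_pos_of_nonneg_of_pos (mul_self_nonneg _) (mul_pos hb hb)).ne'
  simp [Complex.normSq_apply]
  field_simp

lemma AdmissibleShearFlow.tail {U : ℝ → ℝ} (hU : AdmissibleShearFlow U) {s : Set ℝ}
    (hs : MeasurableSet s) (hsub : s ⊆ Ioi 0) {k : ℝ → ℝ} {C : ℝ} (hC : 0 ≤ C)
    (hk : ∀ y ∈ s, |k y| ≤ C) :
    |∫ y in s, hker U y * k y| ≤ C * ∫ y in Ioi (0:ℝ), |hker U y| := by
  have hi : IntegrableOn (fun y => |hker U y|) (Ioi 0) := hU.integrable_hker.abs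
  have h1 : |∫ y in s, hker U y * k y| ≤ ∫ y in s, C * |hker U y| := by
    rw [← Real.norm_eq_abs]
    apply norm_integral_le_of_norm_le ((hi.mono_set hsub).const_mul C)
    filter_upwards [ae_restrict_mem hs] with y hy
    rw [norm_mul, mul_comm, Real.norm_eq_abs, Real.norm_eq_abs]
    exact mul_le_mul_of_nonneg_right (hk y hy) (abs_nonneg _)
  rw [integral_const_mul] at h1
  refine h1.trans (mul_le_mul_of_nonneg_left ?_ hC)
  exact setIntegral_mono_set hi (Eventually.of_forall fun y => abs_nonneg _)
    (LE.le.eventuallyLE hsub)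

lemma AdmissibleShearFlow.exists_inv {U : ℝ → ℝ} (hU : AdmissibleShearFlow U) {Y v : ℝ}
    (h1 : U Y ≤ v) (h2 : v < 1) : ∃ y, Y ≤ y ∧ U y = v := by
  obtain ⟨z, hz1, hz2⟩ := ((hU.tendsto_one.eventually (lt_mem_nhds h2)).and
    (eventually_ge_atTop Y)).exists
  obtain ⟨y, hy, hyv⟩ := intermediate_value_Icc hz2 hU.cont.continuousOn ⟨h1, hz1.le⟩
  exact ⟨y, hy.1, hyv⟩

lemma AdmissibleShearFlow.contP {U : ℝ → ℝ} (hU : AdmissibleShearFlow U) {a b : ℝ}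
    (hb : 0 < b) : Continuous (fun y => deriv U y * (b / ((U y - a) ^ 2 + b ^ 2))) := by
  refine hU.contd.mul (continuous_const.div ?_ fun y => by positivity)
  have := hU.cont
  fun_prop

lemma AdmissibleShearFlow.int_deriv {U : ℝ → ℝ} (hU : AdmissibleShearFlow U) {x z : ℝ}
    (hxz : x ≤ z) : ∫ y in Ioc x z, deriv U y = U z - U x := by
  rw [← intervalIntegral.integral_of_le hxz]
  exact intervalIntegral.integral_eq_sub_of_hasDerivAt (fun y _ => hU.hd y)
    (hU.contd.intervalIntegrable _ _)

lemma AdmissibleShearFlow.int_P {U : ℝ → ℝ} (hU : AdmissibleShearFlow U) {a b x z : ℝ}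
    (hb : 0 < b) (hxz : x ≤ z) :
    ∫ y in Ioc x z, deriv U y * (b / ((U y - a) ^ 2 + b ^ 2)) =
      Real.arctan ((U z - a) / b) - Real.arctan ((U x - a) / b) := by
  rw [← intervalIntegral.integral_of_le hxz]
  apply intervalIntegral.integral_eq_sub_of_hasDerivAt
    (f := fun y => Real.arctan ((U y - a) / b))
  · intro y _
    refine (((hU.hd y).sub_const a).div_const b).arctan.congr_deriv ?_
    have : (U y - a) ^ 2 + b ^ 2 ≠ 0 := by positivity
    field_simp
    ring
  · exact (hU.contP hb).intervalIntegrable _ _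

lemma AdmissibleShearFlow.split {U : ℝ → ℝ} (_hU : AdmissibleShearFlow U) {f : ℝ → ℝ} {Y : ℝ}
    (hY : 0 ≤ Y) (hf : IntegrableOn f (Ioi 0)) :
    ∫ y in Ioi (0:ℝ), f y = (∫ y in Ioc 0 Y, f y) + ∫ y in Ioi Y, f y := by
  rw [← Ioc_union_Ioi_eq_Ioi hY]
  exact setIntegral_union (Ioc_disjoint_Ioi le_rfl) measurableSet_Ioi
    (hf.mono_set Ioc_subset_Ioi_self) (hf.mono_set (Ioi_subset_Ioi hY))

lemma AdmissibleShearFlow.near_one {U : ℝ → ℝ} (hU : AdmissibleShearFlow U)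
    {κ Y cκ : ℝ} (hκ0 : 0 < κ) (hκ12 : κ < 1/2) (hY : 0 < Y) (hcκ : 0 < cκ)
    (hdec : ∀ y, Y ≤ y →
      (1 - U y) ^ ((2:ℝ) - κ) * iteratedDeriv 2 U y ≤ -cκ * (deriv U y) ^ 3) :
    ∃ ρ₀ : ℝ, 0 < ρ₀ ∧ ∀ ρ, 0 < ρ → ρ ≤ ρ₀ →
      (∀ a ∈ Icc (1 - ρ) 1, ∀ b ∈ Ioc (0:ℝ) ρ,
        (PhiInv U ((a : ℂ) + (b : ℂ) * Complex.I)).im ≤ -(cκ / 10) * b ^ κ) := by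
  set N := ∫ y in Ioi (0:ℝ), |hker U y| with hN
  have hN0 : 0 ≤ N := integral_nonneg fun y => abs_nonneg _
  set δ := 1 - U Y with hδ
  have hδ0 : 0 < δ := by have := (hU.mem_Ico Y hY.le).2; linarith
  set C := 4 * N / δ ^ 2 with hC
  have hC0 : 0 ≤ C := by positivity
  refine ⟨min (min 1 (δ / 6)) ((cκ / 10 / (C + 1)) ^ 2), by positivity, ?_⟩
  intro ρ hρ hρ0 a ha b hb
  have r1 : ρ ≤ 1 := hρ0.trans ((min_le_left _ _).trans (min_le_left _ _))
  have r2 : ρ ≤ δ / 6 := hρ0.trans ((min_le_left _ _).trans (min_le_right _ _))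
  have r3 : ρ ≤ (cκ / 10 / (C + 1)) ^ 2 := hρ0.trans (min_le_right _ _)
  obtain ⟨hb0, hbρ⟩ := hb
  obtain ⟨ha1, ha2⟩ := ha
  obtain ⟨hi, him⟩ := hU.phi_im (a := a) hb0
  have hd0 := hU.deriv_pos 0 le_rfl
  have hT : 0 ≤ b / ((a ^ 2 + b ^ 2) * deriv U 0) := by positivity
  -- left part
  have hleft : ∫ y in Ioc 0 Y, hker U y * (b / ((U y - a) ^ 2 + b ^ 2)) ≤ C * b := by
    have := hU.tail (s := Ioc 0 Y) measurableSet_Ioc Ioc_subset_Ioi_self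
      (k := fun y => b / ((U y - a) ^ 2 + b ^ 2)) (C := b / (δ / 2) ^ 2) (by positivity) ?_
    · refine (le_abs_self _).trans (this.trans (le_of_eq ?_))
      rw [← hN, hC]; field_simp; ring
    · intro y hy
      rw [abs_of_nonneg (by positivity)]
      have : U y ≤ U Y := hU.strictMono.monotoneOn hy.1.le hY.le hy.2
      gcongr
      nlinarith
  -- right part
  have hneg : ∀ y, Y ≤ y → hker U y ≤ -cκ * (1 - U y) ^ κ * deriv U y := by
    intro y hy
    have hy0 : 0 ≤ y := hY.le.trans hy
    have hp := hU.deriv_pos y hy0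
    have hs : 0 < 1 - U y := by have := (hU.mem_Ico y hy0).2; linarith
    have h1 := hdec y hy
    have h2 : (1 - U y) ^ 2 = (1 - U y) ^ κ * (1 - U y) ^ ((2:ℝ) - κ) := by
      rw [← Real.rpow_add hs, ← Real.rpow_natCast]; norm_num
    unfold hker
    rw [div_le_iff₀ (by positivity), h2, mul_assoc]
    calc _ ≤ (1 - U y) ^ κ * (-cκ * (deriv U y) ^ 3) := by gcongr
      _ = _ := by ring
  obtain ⟨y1, hy1, hUy1⟩ := hU.exists_inv (Y := Y) (v := a - 2 * b) (by linarith) (by linarith)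
  obtain ⟨y2, hy2, hUy2⟩ := hU.exists_inv (Y := y1) (v := a - b) (by linarith) (by linarith)
  have hbκ : 0 < b ^ κ := Real.rpow_pos_of_pos hb0 κ
  have hsub : Ioc y1 y2 ⊆ Ioi Y := fun y hy => lt_of_le_of_lt hy1 hy.1
  have hright1 : ∫ y in Ioi Y, hker U y * (b / ((U y - a) ^ 2 + b ^ 2)) ≤
      ∫ y in Ioc y1 y2, hker U y * (b / ((U y - a) ^ 2 + b ^ 2)) := by
    have := setIntegral_mono_set (μ := volume) (s := Ioc y1 y2) (t := Ioi Y)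
      (f := fun y => -(hker U y * (b / ((U y - a) ^ 2 + b ^ 2))))
      (hi.mono_set (Ioi_subset_Ioi hY.le)).neg ?_ (LE.le.eventuallyLE hsub)
    · rw [integral_neg, integral_neg] at this
      linarith
    · filter_upwards [ae_restrict_mem measurableSet_Ioi] with y hy
      have hy' : Y ≤ y := le_of_lt hy
      have hy0 : 0 ≤ y := hY.le.trans hy'
      have hp := hU.deriv_pos y hy0
      have hs : 0 < 1 - U y := by have := (hU.mem_Ico y hy0).2; linarith
      have h1 := hneg y hy'
      have h2 : 0 ≤ cκ * (1 - U y) ^ κ * deriv U y := by positivity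
      have h3 : hker U y ≤ 0 := by linarith
      have : hker U y * (b / ((U y - a) ^ 2 + b ^ 2)) ≤ 0 :=
        mul_nonpos_of_nonpos_of_nonneg h3 (by positivity)
      simpa using this
  have hright2 : ∫ y in Ioc y1 y2, hker U y * (b / ((U y - a) ^ 2 + b ^ 2)) ≤
      ∫ y in Ioc y1 y2, (-(cκ * b ^ κ / (5 * b))) * deriv U y := by
    apply setIntegral_mono_on (hi.mono_set (hsub.trans (Ioi_subset_Ioi hY.le)))
      ((hU.contd.integrableOn_Ioc).const_mul _) measurableSet_Ioc
    intro y hy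
    have hy' : Y ≤ y := le_of_lt (hsub hy)
    have hy0 : 0 ≤ y := hY.le.trans hy'
    have hp := hU.deriv_pos y hy0
    have hy10 : 0 ≤ y1 := hY.le.trans hy1
    have u1 : U y1 ≤ U y := hU.strictMono.monotoneOn hy10 hy0 hy.1.le
    have u2 : U y ≤ U y2 := hU.strictMono.monotoneOn hy0 (hy10.trans hy2) hy.2
    rw [hUy1] at u1
    rw [hUy2] at u2
    have h1 : b ^ κ ≤ (1 - U y) ^ κ := Real.rpow_le_rpow hb0.le (by linarith) hκ0.le
    have h2 : 1 / (5 * b) ≤ b / ((U y - a) ^ 2 + b ^ 2) := by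
      rw [div_le_div_iff₀ (by positivity) (by positivity)]
      nlinarith
    have h3 := hneg y hy'
    have h4 : cκ * b ^ κ * deriv U y ≤ - hker U y := by
      have : cκ * b ^ κ * deriv U y ≤ cκ * (1 - U y) ^ κ * deriv U y := by gcongr
      linarith
    have h5 : cκ * b ^ κ * deriv U y * (1 / (5 * b)) ≤
        (- hker U y) * (b / ((U y - a) ^ 2 + b ^ 2)) :=
      mul_le_mul h4 h2 (by positivity) (le_trans (by positivity) h4)
    have h6 : -(cκ * b ^ κ / (5 * b)) * deriv U y = -(cκ * b ^ κ * deriv U y * (1 / (5 * b))) := by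
      ring
    rw [h6]; linarith
  rw [integral_const_mul, hU.int_deriv hy2, hUy1, hUy2] at hright2
  have h7 : -(cκ * b ^ κ / (5 * b)) * (a - b - (a - 2 * b)) = -(cκ / 5) * b ^ κ := by
    field_simp; ring
  rw [h7] at hright2
  have h8 : b ≤ b ^ κ * (cκ / 10 / (C + 1)) := by
    have e1 : b = b ^ κ * b ^ (1 - κ) := by
      rw [← Real.rpow_add hb0]; simp
    have e2 : b ^ (1 - κ) ≤ b ^ (1 / 2 : ℝ) :=
      Real.rpow_le_rpow_of_exponent_ge hb0 (hbρ.trans r1) (by linarith)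
    have e3 : b ^ (1 / 2 : ℝ) ≤ cκ / 10 / (C + 1) := by
      rw [← Real.sqrt_eq_rpow]
      exact Real.sqrt_le_iff.mpr ⟨by positivity, hbρ.trans r3⟩
    calc b = b ^ κ * b ^ (1 - κ) := e1
      _ ≤ _ := by gcongr; exact e2.trans e3
  have h9 : C * b ≤ b ^ κ * (cκ / 10) := by
    calc C * b ≤ (C + 1) * (b ^ κ * (cκ / 10 / (C + 1))) := by gcongr; linarith
      _ = _ := by field_simp
  rw [him, hU.split hY.le hi]
  linarith

lemma AdmissibleShearFlow.exists_eta {U : ℝ → ℝ} (hU : AdmissibleShearFlow U) {γ ε : ℝ}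
    (hγ : γ = iteratedDeriv 2 U 0 / deriv U 0 ^ 3) (hγ0 : γ ≠ 0) (hε : 0 < ε) :
    ∃ η, 0 < η ∧ U η ≤ ε ^ 2 ∧ ∀ y ∈ Ioc 0 η,
      |hker U y - γ * deriv U y| ≤ |γ| / 2 * deriv U y := by
  have hd0 := hU.deriv_pos 0 le_rfl
  have hc : ContinuousAt (fun y => (1 - U y) ^ 2 * iteratedDeriv 2 U y / (deriv U y) ^ 3) 0 := by
    apply ContinuousAt.div
    · exact (((continuous_const.sub hU.cont).pow 2).mul hU.contd2).continuousAt
    · exact (hU.contd.pow 3).continuousAt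
    · positivity
  have hv : (fun y => (1 - U y) ^ 2 * iteratedDeriv 2 U y / (deriv U y) ^ 3) 0 = γ := by
    simp [hU.zero_val, hγ]
  have e1 : ∀ᶠ y in nhds (0:ℝ),
      |(1 - U y) ^ 2 * iteratedDeriv 2 U y / (deriv U y) ^ 3 - γ| < |γ| / 2 := by
    have := Metric.tendsto_nhds.mp hc (|γ| / 2) (by positivity)
    rw [hv] at this
    simpa [Real.dist_eq] using this
  have e2 : ∀ᶠ y in nhds (0:ℝ), U y < ε ^ 2 := by
    apply hU.cont.continuousAt.eventually_lt continuousAt_const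
    rw [hU.zero_val]; positivity
  obtain ⟨r, hr, hball⟩ := Metric.eventually_nhds_iff.mp (e1.and e2)
  refine ⟨r / 2, by positivity, ?_, ?_⟩
  · refine (hball ?_).2.le
    rw [Real.dist_eq, sub_zero, abs_of_pos (by positivity)]; linarith
  · intro y hy
    have hp := hU.deriv_pos y hy.1.le
    have h1 := (hball (y := y) (by
      rw [Real.dist_eq, sub_zero, abs_of_pos hy.1]; linarith [hy.2])).1.le
    have h2 : hker U y - γ * deriv U y =
        ((1 - U y) ^ 2 * iteratedDeriv 2 U y / (deriv U y) ^ 3 - γ) * deriv U y := by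
      unfold hker; field_simp
    rw [h2, abs_mul, abs_of_pos hp]
    gcongr

set_option maxHeartbeats 1000000 in
lemma AdmissibleShearFlow.core_zero {U : ℝ → ℝ} (hU : AdmissibleShearFlow U) {γ ε : ℝ}
    (hγ : γ = iteratedDeriv 2 U 0 / deriv U 0 ^ 3) (hγ0 : γ ≠ 0) (hε : 0 < ε) :
    ∃ ρ₀ : ℝ, 0 < ρ₀ ∧ ∃ C : ℝ, 0 ≤ C ∧ ∀ a b : ℝ, 0 ≤ a → a ≤ ρ₀ → 0 < b → b ≤ ρ₀ →
      |∫ y in Ioi (0:ℝ), hker U y * (b / ((U y - a) ^ 2 + b ^ 2))| ≤ 3 * |γ| * Real.pi ∧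
      γ ^ 2 * Real.pi / 16 ≤
        γ * ∫ y in Ioi (0:ℝ), hker U y * (b / ((U y - a) ^ 2 + b ^ 2)) ∧
      |∫ y in Ioi (0:ℝ), hker U y * ((U y - a) / ((U y - a) ^ 2 + b ^ 2))| ≤
        5 * |γ| * ε / Real.sqrt b + C := by
  obtain ⟨η, hη, hUη, hnear⟩ := hU.exists_eta hγ hγ0 hε
  set N := ∫ y in Ioi (0:ℝ), |hker U y| with hN
  have hN0 : 0 ≤ N := integral_nonneg fun y => abs_nonneg _
  set u := U η with hu
  have hu0 : 0 < u := by
    have := hU.strictMono (a := 0) (b := η) self_mem_Ici hη.le hη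
    rwa [hU.zero_val] at this
  have hπ := Real.pi_pos
  have hπ4 := Real.pi_le_four
  have hγa : 0 < |γ| := abs_pos.mpr hγ0
  refine ⟨min (u / 4) (|γ| * Real.pi / 16 / (4 * N / u ^ 2 + 1)), by positivity,
    2 * N / u, by positivity, ?_⟩
  intro a b ha0 haρ hb0 hbρ
  have a1 : a ≤ u / 4 := haρ.trans (min_le_left _ _)
  have b1 : b ≤ u / 4 := hbρ.trans (min_le_left _ _)
  have b2 : b ≤ |γ| * Real.pi / 16 / (4 * N / u ^ 2 + 1) := hbρ.trans (min_le_right _ _)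
  have htail : ∀ y ∈ Ioi η, u / 2 ≤ U y - a := by
    intro y hy
    have : U η ≤ U y := hU.strictMono.monotoneOn hη.le (hη.le.trans (le_of_lt hy)) (le_of_lt hy)
    linarith
  -- the Poisson integral
  set P0 := ∫ y in Ioc 0 η, deriv U y * (b / ((U y - a) ^ 2 + b ^ 2)) with hP0
  have hPval : P0 = Real.arctan ((u - a) / b) + Real.arctan (a / b) := by
    rw [hP0, hU.int_P hb0 hη.le, hU.zero_val, zero_sub, neg_div, Real.arctan_neg, sub_neg_eq_add]
  have hPup : P0 ≤ Real.pi := by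
    have := Real.arctan_lt_pi_div_two ((u - a) / b)
    have := Real.arctan_lt_pi_div_two (a / b)
    linarith
  have hPlo : Real.pi / 4 ≤ P0 := by
    have h1 : Real.arctan 1 ≤ Real.arctan ((u - a) / b) := by
      apply Real.arctan_strictMono.monotone
      rw [le_div_iff₀ hb0]; linarith
    have h2 : Real.arctan 0 ≤ Real.arctan (a / b) :=
      Real.arctan_strictMono.monotone (by positivity)
    rw [Real.arctan_one] at h1
    rw [Real.arctan_zero] at h2
    linarith
  have hPi : IntegrableOn (fun y => deriv U y * (b / ((U y - a) ^ 2 + b ^ 2))) (Ioc 0 η) :=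
    (hU.contP hb0).integrableOn_Ioc
  obtain ⟨hi, -⟩ := hU.phi_im (a := a) hb0
  obtain ⟨hj, -⟩ := hU.phi_re (a := a) hb0
  -- imaginary part
  have hI : |(∫ y in Ioi (0:ℝ), hker U y * (b / ((U y - a) ^ 2 + b ^ 2))) - γ * P0| ≤
      |γ| / 2 * P0 + |γ| * Real.pi / 16 := by
    rw [hU.split hη.le hi]
    have t1 : |∫ y in Ioi η, hker U y * (b / ((U y - a) ^ 2 + b ^ 2))| ≤ |γ| * Real.pi / 16 := by
      have := hU.tail (s := Ioi η) measurableSet_Ioi (Ioi_subset_Ioi hη.le)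
        (k := fun y => b / ((U y - a) ^ 2 + b ^ 2)) (C := b / (u / 2) ^ 2) (by positivity) ?_
      · refine this.trans ?_
        rw [← hN]
        rw [le_div_iff₀ (by positivity)] at b2
        calc b / (u / 2) ^ 2 * N = b * (4 * N / u ^ 2) := by field_simp; ring
          _ ≤ b * (4 * N / u ^ 2 + 1) := by gcongr; linarith
          _ ≤ _ := b2
      · intro y hy
        have := htail y hy
        rw [abs_of_nonneg (by positivity)]
        gcongr
        nlinarith
    have t2 : |(∫ y in Ioc 0 η, hker U y * (b / ((U y - a) ^ 2 + b ^ 2))) - γ * P0| ≤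
        |γ| / 2 * P0 := by
      rw [hP0, ← integral_const_mul, ← integral_const_mul,
        ← integral_sub (hi.mono_set Ioc_subset_Ioi_self) (hPi.const_mul γ), ← Real.norm_eq_abs]
      apply norm_integral_le_of_norm_le (hPi.const_mul _)
      filter_upwards [ae_restrict_mem measurableSet_Ioc] with y hy
      have h1 := hnear y hy
      have h2 : 0 ≤ b / ((U y - a) ^ 2 + b ^ 2) := by positivity
      have h3 : hker U y * (b / ((U y - a) ^ 2 + b ^ 2)) -
          γ * (deriv U y * (b / ((U y - a) ^ 2 + b ^ 2))) =
          (hker U y - γ * deriv U y) * (b / ((U y - a) ^ 2 + b ^ 2)) := by ring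
      rw [h3, Real.norm_eq_abs, abs_mul, abs_of_nonneg h2, ← mul_assoc]
      gcongr
    rw [add_sub_right_comm]
    exact (abs_add_le _ _).trans (add_le_add t2 t1)
  set I := ∫ y in Ioi (0:ℝ), hker U y * (b / ((U y - a) ^ 2 + b ^ 2)) with hIdef
  refine ⟨?_, ?_, ?_⟩
  · have h1 : |I| ≤ |I - γ * P0| + |γ * P0| := by
      have := abs_add_le (I - γ * P0) (γ * P0)
      rwa [sub_add_cancel] at this
    rw [abs_mul, abs_of_nonneg (show (0:ℝ) ≤ P0 by linarith)] at h1
    nlinarith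
  · have h1 : |γ * (I - γ * P0)| ≤ |γ| * (|γ| / 2 * P0 + |γ| * Real.pi / 16) := by
      rw [abs_mul]; gcongr
    have h2 := (abs_le.mp h1).1
    have h3 : |γ| * (|γ| / 2 * P0 + |γ| * Real.pi / 16) = γ ^ 2 * (P0 / 2 + Real.pi / 16) := by
      rw [← sq_abs γ]; ring
    rw [h3] at h2
    nlinarith [sq_nonneg γ, mul_le_mul_of_nonneg_left hPlo (sq_nonneg γ)]
  · rw [hU.split hη.le hj]
    have t1 : |∫ y in Ioi η, hker U y * ((U y - a) / ((U y - a) ^ 2 + b ^ 2))| ≤ 2 * N / u := by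
      have := hU.tail (s := Ioi η) measurableSet_Ioi (Ioi_subset_Ioi hη.le)
        (k := fun y => (U y - a) / ((U y - a) ^ 2 + b ^ 2)) (C := 2 / u) (by positivity) ?_
      · refine this.trans (le_of_eq ?_)
        rw [← hN]; ring
      · intro y hy
        have := htail y hy
        have h0 : 0 < U y - a := by linarith
        rw [abs_of_nonneg (by positivity), div_le_div_iff₀ (by positivity) hu0]
        nlinarith
    have hsb : 0 < Real.sqrt b := Real.sqrt_pos.mpr hb0
    have hsq : Real.sqrt b ^ 2 = b := Real.sq_sqrt hb0.le
    have t2 : |∫ y in Ioc 0 η, hker U y * ((U y - a) / ((U y - a) ^ 2 + b ^ 2))| ≤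
        5 * |γ| * ε / Real.sqrt b := by
      have hgi : IntegrableOn (fun y => (|γ| * (ε / Real.sqrt b)) *
          (deriv U y * (b / ((U y - a) ^ 2 + b ^ 2))) +
          (|γ| * (1 / (ε * Real.sqrt b))) * deriv U y) (Ioc 0 η) :=
        (hPi.const_mul _).add (hU.contd.integrableOn_Ioc.const_mul _)
      have h1 : |∫ y in Ioc 0 η, hker U y * ((U y - a) / ((U y - a) ^ 2 + b ^ 2))| ≤
          ∫ y in Ioc 0 η, ((|γ| * (ε / Real.sqrt b)) *
          (deriv U y * (b / ((U y - a) ^ 2 + b ^ 2))) +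
          (|γ| * (1 / (ε * Real.sqrt b))) * deriv U y) := by
        rw [← Real.norm_eq_abs]
        apply norm_integral_le_of_norm_le hgi
        filter_upwards [ae_restrict_mem measurableSet_Ioc] with y hy
        have hp := hU.deriv_pos y hy.1.le
        have k1 : |hker U y| ≤ 2 * |γ| * deriv U y := by
          have := hnear y hy
          have h := abs_add_le (hker U y - γ * deriv U y) (γ * deriv U y)
          rw [sub_add_cancel, abs_mul γ, abs_of_pos hp] at h
          have q3 := mul_pos hγa hp
          linarith
        have hD : 0 < (U y - a) ^ 2 + b ^ 2 := by positivity
        have k2 : |(U y - a) / ((U y - a) ^ 2 + b ^ 2)| ≤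
            1 / 2 * (ε / Real.sqrt b * (b / ((U y - a) ^ 2 + b ^ 2)) + 1 / (ε * Real.sqrt b)) := by
          rw [abs_div, abs_of_pos hD, div_le_iff₀ hD]
          set s := Real.sqrt b
          have e1 : 1 / 2 * (ε / s * (b / ((U y - a) ^ 2 + b ^ 2)) + 1 / (ε * s)) *
              ((U y - a) ^ 2 + b ^ 2) =
              ((ε * s) ^ 2 + ((U y - a) ^ 2 + b ^ 2)) / (2 * (ε * s)) := by
            rw [← hsq] at hD ⊢
            field_simp
          rw [e1, le_div_iff₀ (by positivity), ← sq_abs (U y - a)]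
          have q1 := sq_nonneg (|U y - a| - ε * s)
          have q2 := sq_nonneg b
          linear_combination q1 + q2
        rw [norm_mul, Real.norm_eq_abs, Real.norm_eq_abs]
        refine (mul_le_mul k1 k2 (abs_nonneg _) (by positivity)).trans (le_of_eq ?_)
        ring
      rw [integral_add (hPi.const_mul _) (hU.contd.integrableOn_Ioc.const_mul _),
        integral_const_mul, integral_const_mul, hU.int_deriv hη.le, hU.zero_val, sub_zero,
        ← hP0] at h1
      refine h1.trans ?_
      have e2 : |γ| * (1 / (ε * Real.sqrt b)) * u ≤ |γ| * (1 / (ε * Real.sqrt b)) * ε ^ 2 := by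
        gcongr
      have e3 : |γ| * (ε / Real.sqrt b) * P0 ≤ |γ| * (ε / Real.sqrt b) * 4 := by
        gcongr
        linarith
      have e4 : |γ| * (1 / (ε * Real.sqrt b)) * ε ^ 2 = |γ| * ε / Real.sqrt b := by
        field_simp
      have e5 : |γ| * (ε / Real.sqrt b) * 4 + |γ| * ε / Real.sqrt b =
        5 * |γ| * ε / Real.sqrt b := by ring
      linarith
    exact (abs_add_le _ _).trans (add_le_add t2 t1)

set_option maxHeartbeats 1000000 in
/-- Lemma (behavior of `Φ_inv` near the endpoints of `[0,1]`). -/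
theorem phiInv_near_endpoints (U : ℝ → ℝ) (hU : AdmissibleShearFlow U)
    (κ yκ cκ : ℝ) (hκ0 : 0 < κ) (hκ12 : κ < 1/2) (hyκ : 0 < yκ) (hcκ : 0 < cκ)
    (hdec : ∀ y, yκ ≤ y →
      (1 - U y) ^ ((2:ℝ) - κ) * iteratedDeriv 2 U y ≤ -cκ * (deriv U y) ^ 3) :
    ∃ c : ℝ, 0 < c ∧ ∃ ρ : ℝ, 0 < ρ ∧
      (∀ a ∈ Icc (0:ℝ) ρ, ∀ b ∈ Ioc (0:ℝ) ρ,
        (c ≤ |(PhiInv U ((a : ℂ) + (b : ℂ) * Complex.I)).im| ∨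
          c / Real.sqrt b ≤ (PhiInv U ((a : ℂ) + (b : ℂ) * Complex.I)).re) ∧
        (a * (1 - a) ≤ b ^ 2 →
          (PhiInv U ((a : ℂ) + (b : ℂ) * Complex.I)).im ≤ -c)) ∧
      (∀ a ∈ Icc (1 - ρ) 1, ∀ b ∈ Ioc (0:ℝ) ρ,
        (PhiInv U ((a : ℂ) + (b : ℂ) * Complex.I)).im ≤ -c * b ^ κ) := by
  obtain ⟨ρ₁, hρ₁, h1⟩ := hU.near_one hκ0 hκ12 hyκ hcκ hdec
  have hd := hU.deriv_pos 0 le_rfl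
  set d := deriv U 0 with hdd
  set γ := iteratedDeriv 2 U 0 / d ^ 3 with hγ
  have hγ0 : γ ≠ 0 := div_ne_zero hU.snd_deriv_zero_ne (by positivity)
  have hγa : 0 < |γ| := abs_pos.mpr hγ0
  have hπ := Real.pi_pos
  set m := |γ| * Real.pi / 16 with hm
  set M := 3 * |γ| * Real.pi with hM
  have hm0 : 0 < m := by positivity
  have hM0 : 0 < M := by positivity
  have hmM : m ≤ M := by rw [hm, hM]; nlinarith [mul_pos hγa hπ]
  set K := 2 * M * d with hK
  have hK0 : 0 < K := by positivity
  set c1 := m / (2 * Real.sqrt (2 * K)) with hc1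
  have hc10 : 0 < c1 := by positivity
  obtain ⟨ρ₂, hρ₂, C, hC, h2⟩ := hU.core_zero (γ := γ) (ε := c1 / (20 * |γ|)) hγ hγ0
    (by positivity)
  have e0 : 5 * |γ| * (c1 / (20 * |γ|)) = c1 / 4 := by field_simp; norm_num
  rw [e0] at h2
  set ρ := min (min ρ₁ ρ₂) (min (min (1 / 2) (1 / (2 * K))) ((c1 / 4 / (C + 1)) ^ 2)) with hρ
  have hρ0 : 0 < ρ := by positivity
  have r1 : ρ ≤ ρ₁ := (min_le_left _ _).trans (min_le_left _ _)
  have r2 : ρ ≤ ρ₂ := (min_le_left _ _).trans (min_le_right _ _)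
  have r3 : ρ ≤ 1 / 2 := (min_le_right _ _).trans ((min_le_left _ _).trans (min_le_left _ _))
  have r4 : ρ ≤ 1 / (2 * K) := (min_le_right _ _).trans ((min_le_left _ _).trans (min_le_right _ _))
  have r5 : ρ ≤ (c1 / 4 / (C + 1)) ^ 2 := (min_le_right _ _).trans (min_le_right _ _)
  clear_value ρ
  set c := min (min (m / 2) (c1 / 2)) (cκ / 10) with hc
  have c1' : c ≤ m / 2 := (min_le_left _ _).trans (min_le_left _ _)
  have c2' : c ≤ c1 / 2 := (min_le_left _ _).trans (min_le_right _ _)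
  have c3' : c ≤ cκ / 10 := min_le_right _ _
  have hc0 : 0 < c := by positivity
  refine ⟨c, hc0, ρ, hρ0, ?_, ?_⟩
  · rintro a ⟨ha0, haρ⟩ b ⟨hb0, hbρ⟩
    obtain ⟨hI1, hI2, hJ⟩ := h2 a b ha0 (haρ.trans r2) hb0 (hbρ.trans r2)
    rw [(hU.phi_im (a := a) hb0).2, (hU.phi_re (a := a) hb0).2, ← hdd]
    set I := ∫ y in Ioi (0:ℝ), hker U y * (b / ((U y - a) ^ 2 + b ^ 2))
    set J := ∫ y in Ioi (0:ℝ), hker U y * ((U y - a) / ((U y - a) ^ 2 + b ^ 2))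
    have hab : 0 < a ^ 2 + b ^ 2 := by positivity
    set T := b / ((a ^ 2 + b ^ 2) * d) with hT
    have hT0 : 0 < T := by positivity
    have hIM : I ≤ M := (le_abs_self _).trans hI1
    constructor
    · rcases lt_or_gt_of_ne hγ0 with hneg | hpos
      · left
        have hI : I ≤ -m := by
          rw [hm, abs_of_neg hneg]
          nlinarith
        rw [abs_of_neg (by linarith)]
        linarith
      · have hI : m ≤ I := by
          rw [hm, abs_of_pos hpos]
          nlinarith
        by_cases hTm : T ≤ m / 2
        · left
          refine le_trans ?_ (le_abs_self _)
          linarith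
        by_cases hTM : 2 * M ≤ T
        · left
          refine le_trans ?_ (neg_le_abs _)
          linarith
        right
        push Not at hTm hTM
        rw [hT, lt_div_iff₀ (by positivity)] at hTm
        rw [hT, div_lt_iff₀ (by positivity)] at hTM
        have hbK : b * (2 * K) ≤ 1 := by
          have := hbρ.trans r4
          rwa [le_div_iff₀ (by positivity)] at this
        have ha2 : b ≤ 2 * K * a ^ 2 := by
          have : b < K * (a ^ 2 + b ^ 2) := by rw [hK]; linarith
          nlinarith
        have hsb : 0 < Real.sqrt b := Real.sqrt_pos.mpr hb0
        have hsq : Real.sqrt b ^ 2 = b := Real.sq_sqrt hb0.le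
        have ha3 : Real.sqrt b ≤ Real.sqrt (2 * K) * a := by
          apply Real.sqrt_le_iff.mpr
          refine ⟨by positivity, ?_⟩
          rw [mul_pow, Real.sq_sqrt (by positivity)]
          exact ha2
        have hfirst : c1 / Real.sqrt b ≤ a / ((a ^ 2 + b ^ 2) * d) := by
          rw [div_le_div_iff₀ hsb (by positivity), hc1, div_mul_eq_mul_div,
            div_le_iff₀ (by positivity)]
          have f1 : m * ((a ^ 2 + b ^ 2) * d) ≤ 2 * Real.sqrt b ^ 2 := by rw [hsq]; linarith
          have f5 := mul_le_mul_of_nonneg_left ha3 hsb.le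
          linear_combination f1 + 2 * f5
        have hCb : C ≤ c1 / 4 / Real.sqrt b := by
          rw [le_div_iff₀ hsb]
          have f2 : Real.sqrt b ≤ c1 / 4 / (C + 1) :=
            Real.sqrt_le_iff.mpr ⟨by positivity, hbρ.trans r5⟩
          rw [le_div_iff₀ (by positivity)] at f2
          nlinarith
        have hJ' := (abs_le.mp hJ).1
        have f3 : c / Real.sqrt b ≤ c1 / 2 / Real.sqrt b := by gcongr
        have f4 : c1 / 2 / Real.sqrt b = c1 / Real.sqrt b - c1 / 4 / Real.sqrt b
          - c1 / 4 / Real.sqrt b := by ring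
        linarith
    · intro hcond
      have hTM : 2 * M ≤ T := by
        rw [hT, le_div_iff₀ (by positivity)]
        have hbK : b * (2 * K) ≤ 1 := by
          have := hbρ.trans r4
          rwa [le_div_iff₀ (by positivity)] at this
        have g1 : a ≤ 2 * b ^ 2 := by nlinarith
        have g2 : a ^ 2 ≤ b ^ 2 := by
          have : a ≤ b := by nlinarith
          gcongr
        have : 2 * M * ((a ^ 2 + b ^ 2) * d) = K * (a ^ 2 + b ^ 2) := by rw [hK]; ring
        rw [this]
        nlinarith
      linarith
  · intro a ha b hb
    refine (h1 ρ hρ0 r1 a ha b hb).trans ?_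
    have : 0 < b ^ κ := Real.rpow_pos_of_pos hb.1 κ
    nlinarith

end
end

section
/- Let U_s be an admissible shear flow. There exist c > 0 and ρ > 0 such that Re G(a) ≥ c/a for all a ∈ (0, ρ], where G(a) := 1/(a U_s'(0)) + PV ∫₀¹ g(u)/(u − a) du + iπ g(a) and g(a) := (1−a)² U_s''(U_s⁻¹(a)) / (U_s'(U_s⁻¹(a)))³. -/
open MeasureTheory Filter Set

noncomputable section

theorem aux_symm (a ε : ℝ) :
    ∫ u in Ioo (0:ℝ) (2*a) \ Ioo (a - ε) (a + ε), 1 / (u - a) = 0 := by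
  have hm : MeasurableSet (Ioo (0:ℝ) (2*a) \ Ioo (a - ε) (a + ε)) :=
    measurableSet_Ioo.diff measurableSet_Ioo
  rw [← integral_indicator hm]
  set F : ℝ → ℝ := indicator (Ioo (0:ℝ) (2*a) \ Ioo (a - ε) (a + ε)) (fun u => 1 / (u - a)) with hF
  have h1 : ∀ u, F (2*a - u) = - F u := by
    intro u
    have hiff : (2*a - u ∈ Ioo (0:ℝ) (2*a) \ Ioo (a - ε) (a + ε)) ↔
        u ∈ Ioo (0:ℝ) (2*a) \ Ioo (a - ε) (a + ε) := by
      simp only [Set.mem_sdiff, mem_Ioo]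
      constructor
      · rintro ⟨⟨h1, h2⟩, h3⟩
        exact ⟨⟨by linarith, by linarith⟩, fun h => h3 ⟨by linarith [h.2], by linarith [h.1]⟩⟩
      · rintro ⟨⟨h1, h2⟩, h3⟩
        exact ⟨⟨by linarith, by linarith⟩, fun h => h3 ⟨by linarith [h.2], by linarith [h.1]⟩⟩
    by_cases hu : u ∈ Ioo (0:ℝ) (2*a) \ Ioo (a - ε) (a + ε)
    · rw [hF, indicator_of_mem hu, indicator_of_mem (hiff.2 hu), ← neg_sub, ← one_div_neg_eq_neg_one_div]
      congr 1; ring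
    · rw [hF, indicator_of_notMem hu, indicator_of_notMem (fun h => hu (hiff.1 h))]; simp
  have h2 : ∫ u, F (2*a - u) = ∫ u, F u := integral_sub_left_eq_self F volume (2*a)
  simp only [h1, integral_neg] at h2
  linarith

theorem aux_pv (g : ℝ → ℝ) (hg : IntegrableOn g (Ioo (0:ℝ) 1)) (K r : ℝ) (hr1 : r < 1)
    (hK : ∀ u ∈ Ioo (0:ℝ) r, ∀ v ∈ Ioo (0:ℝ) r, |g u - g v| ≤ K * |u - v|) (hK0 : 0 ≤ K)
    (a : ℝ) (ha : 0 < a) (har : 2 * a ≤ r) :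
    pvIntegral g a = (∫ u in Ioo (0:ℝ) (2*a), (g u - g a) / (u - a)) +
      ∫ u in Ico (2*a) 1, g u / (u - a) := by
  set S := Ioo (0:ℝ) (2*a) with hS
  have haS : a ∈ Ioo 0 r := ⟨ha, by linarith⟩
  have hhb : ∀ u ∈ S, ‖(g u - g a) / (u - a)‖ ≤ K := by
    intro u hu
    rw [Real.norm_eq_abs, abs_div]
    exact div_le_of_le_mul₀ (abs_nonneg _) hK0 (hK u ⟨hu.1, hu.2.trans_le har⟩ a haS)
  have hgS : IntegrableOn g S := hg.mono_set (fun u hu => ⟨hu.1, by linarith [hu.2]⟩)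
  have hgT : IntegrableOn g (Ico (2*a) 1) := hg.mono_set (fun u hu => ⟨by linarith [hu.1], hu.2⟩)
  have hhS : IntegrableOn (fun u => (g u - g a) / (u - a)) S := by
    refine Integrable.mono' (integrableOn_const (C := K) (hs := measure_Ioo_lt_top.ne)) ?_ ?_
    · exact ((hgS.aestronglyMeasurable.aemeasurable.sub_const (g a)).div
        (by fun_prop : Measurable fun u : ℝ => u - a).aemeasurable).aestronglyMeasurable
    · exact (ae_restrict_iff' measurableSet_Ioo).2 (Eventually.of_forall hhb)
  have hhT : IntegrableOn (fun u => g u / (u - a)) (Ico (2*a) 1) := by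
    refine Integrable.mono' (hgT.norm.mul_const (1/a)) ?_ ?_
    · exact (hgT.aestronglyMeasurable.aemeasurable.div (by fun_prop)).aestronglyMeasurable
    · refine (ae_restrict_iff' measurableSet_Ico).2 (Eventually.of_forall fun u hu => ?_)
      have h1 : a ≤ u - a := by linarith [hu.1]
      rw [norm_div, div_eq_mul_one_div, Real.norm_eq_abs (u - a), abs_of_pos (by linarith)]
      gcongr
  have key : ∀ ε ∈ Ioo 0 a, |(∫ u in Ioo (0:ℝ) 1 \ Ioo (a - ε) (a + ε), g u / (u - a)) -
      ((∫ u in S, (g u - g a) / (u - a)) + ∫ u in Ico (2*a) 1, g u / (u - a))| ≤ K * (2 * ε) := by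
    intro ε hε
    have hIS : Ioo (a - ε) (a + ε) ⊆ S := fun u hu =>
      ⟨by linarith [hu.1, hε.2], by linarith [hu.2, hε.2]⟩
    have hset : Ioo (0:ℝ) 1 \ Ioo (a - ε) (a + ε) = (S \ Ioo (a - ε) (a + ε)) ∪ Ico (2*a) 1 := by
      ext u
      simp only [Set.mem_sdiff, mem_union, mem_Ioo, mem_Ico, hS]
      constructor
      · rintro ⟨⟨h1, h2⟩, h3⟩
        rcases lt_or_ge u (2*a) with h | h
        · exact Or.inl ⟨⟨h1, h⟩, h3⟩
        · exact Or.inr ⟨h, h2⟩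
      · rintro (⟨⟨h1, h2⟩, h3⟩ | ⟨h1, h2⟩)
        · exact ⟨⟨h1, by linarith⟩, h3⟩
        · exact ⟨⟨by linarith, h2⟩, fun h => by linarith [h.2, hε.2]⟩
    have hmd : MeasurableSet (S \ Ioo (a - ε) (a + ε)) := measurableSet_Ioo.diff measurableSet_Ioo
    have hdisj : Disjoint (S \ Ioo (a - ε) (a + ε)) (Ico (2*a) 1) := by
      rw [Set.disjoint_left]
      intro u hu hu'
      exact absurd hu.1.2 (not_lt.2 hu'.1)
    have hone : IntegrableOn (fun u => 1 / (u - a)) (S \ Ioo (a - ε) (a + ε)) := by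
      refine Measure.integrableOn_of_bounded (M := 1/ε) ?_ ?_ ?_
      · exact ((measure_mono sdiff_subset).trans_lt measure_Ioo_lt_top).ne
      · exact (by fun_prop : Measurable fun u : ℝ => 1 / (u - a)).aestronglyMeasurable
      · refine (ae_restrict_iff' hmd).2 (Eventually.of_forall fun u hu => ?_)
        have h1 : ε ≤ |u - a| := by
          by_contra h
          push Not at h
          rw [abs_lt] at h
          exact hu.2 ⟨by linarith [h.1], by linarith [h.2]⟩
        rw [norm_div, norm_one, Real.norm_eq_abs]
        exact one_div_le_one_div_of_le hε.1 h1
    have hhSI := hhS.mono_set (sdiff_subset : S \ Ioo (a - ε) (a + ε) ⊆ S)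
    have heq : (fun u => g u / (u - a)) =
        fun u => (g u - g a) / (u - a) + g a * (1 / (u - a)) := by
      ext u; ring
    have hgSI : IntegrableOn (fun u => g u / (u - a)) (S \ Ioo (a - ε) (a + ε)) := by
      rw [heq]; exact hhSI.add (hone.const_mul _)
    have h1 : ∫ u in S \ Ioo (a - ε) (a + ε), g u / (u - a) =
        ∫ u in S \ Ioo (a - ε) (a + ε), (g u - g a) / (u - a) := by
      rw [heq, integral_add hhSI (hone.const_mul _), integral_const_mul, hS, aux_symm]
      ring
    rw [hset, setIntegral_union hdisj measurableSet_Ico hgSI hhT, h1,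
      setIntegral_sdiff measurableSet_Ioo hhS hIS]
    have h2 := norm_setIntegral_le_of_norm_le_const (μ := volume) (s := Ioo (a - ε) (a + ε))
      (f := fun u => (g u - g a) / (u - a)) (C := K) (by simp) (fun u hu => hhb u (hIS hu))
    rw [Real.norm_eq_abs, Real.volume_real_Ioo_of_le (by linarith [hε.1])] at h2
    have e : ∀ x y z : ℝ, x - y + z - (x + z) = -y := by intros; ring
    rw [e, abs_neg]
    convert h2 using 2; ring
  unfold pvIntegral
  refine Tendsto.limUnder_eq ?_
  rw [tendsto_iff_norm_sub_tendsto_zero]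
  refine squeeze_zero' (g := fun ε => K * (2 * ε)) (Eventually.of_forall fun _ => norm_nonneg _) ?_ ?_
  · filter_upwards [Ioo_mem_nhdsGT ha] with ε hε
    exact key ε hε
  · have : Tendsto (fun ε : ℝ => K * (2 * ε)) (nhds 0) (nhds (K * (2 * 0))) :=
      (by fun_prop : Continuous fun ε : ℝ => K * (2 * ε)).tendsto 0
    simp only [mul_zero] at this
    exact this.mono_left nhdsWithin_le_nhds

theorem aux_bound (g : ℝ → ℝ) (hg : IntegrableOn g (Ioo (0:ℝ) 1)) (K r : ℝ) (hr : 0 < r)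
    (hr1 : r < 1)
    (hK : ∀ u ∈ Ioo (0:ℝ) r, ∀ v ∈ Ioo (0:ℝ) r, |g u - g v| ≤ K * |u - v|) (hK0 : 0 ≤ K)
    (B : ℝ) (hB : 0 < B) :
    ∃ ρ : ℝ, 0 < ρ ∧ ∀ a ∈ Ioc (0:ℝ) ρ, -(B / a) ≤ pvIntegral g a := by
  obtain ⟨M, hM0, hM⟩ : ∃ M : ℝ, 0 < M ∧ ∀ u ∈ Ioo (0:ℝ) r, |g u| ≤ M := by
    refine ⟨|g (r/2)| + K * r + 1, by positivity, fun u hu => ?_⟩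
    have h1 := hK u hu (r/2) ⟨by linarith, by linarith⟩
    have h2 : |u - r/2| ≤ r := by rw [abs_le]; constructor <;> linarith [hu.1, hu.2]
    have h3 : |g u| ≤ |g u - g (r/2)| + |g (r/2)| := by
      simpa using abs_add_le (g u - g (r/2)) (g (r/2))
    have h4 := mul_le_mul_of_nonneg_left h2 hK0
    linarith
  obtain ⟨δ, hδ0, hδr, hδM⟩ : ∃ δ : ℝ, 0 < δ ∧ δ ≤ r ∧ M * δ ≤ B / 2 := by
    refine ⟨min r (B / (2 * M)), by positivity, min_le_left _ _, ?_⟩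
    calc M * min r (B / (2 * M)) ≤ M * (B / (2 * M)) := by gcongr; exact min_le_right _ _
      _ = B / 2 := by field_simp
  set N := ∫ u in Ioo (0:ℝ) 1, |g u| with hN
  have hN0 : 0 ≤ N := integral_nonneg fun _ => abs_nonneg _
  set C := 2 * K + 2 / δ * N + 1 with hC
  have hC0 : 0 < C := by positivity
  refine ⟨min (δ / 2) (min 1 (B / 2 / C)), by positivity, fun a ha => ?_⟩
  have ha0 := ha.1
  have ha1 : a ≤ δ / 2 := ha.2.trans (min_le_left _ _)
  have ha2 : a ≤ 1 := ha.2.trans ((min_le_right _ _).trans (min_le_left _ _))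
  have ha3 : a ≤ B / 2 / C := ha.2.trans ((min_le_right _ _).trans (min_le_right _ _))
  rw [aux_pv g hg K r hr1 hK hK0 a ha0 (by linarith)]
  have h1 : |∫ u in Ioo (0:ℝ) (2*a), (g u - g a) / (u - a)| ≤ K * (2 * a) := by
    have := norm_setIntegral_le_of_norm_le_const (μ := volume) (s := Ioo (0:ℝ) (2*a))
      (f := fun u => (g u - g a) / (u - a)) (C := K) measure_Ioo_lt_top (by
        intro u hu
        rw [Real.norm_eq_abs, abs_div]
        exact div_le_of_le_mul₀ (abs_nonneg _) hK0
          (hK u ⟨hu.1, by linarith [hu.2]⟩ a ⟨ha0, by linarith⟩))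
    rw [Real.norm_eq_abs, Real.volume_real_Ioo_of_le (by linarith)] at this
    simpa using this
  have h2 : |∫ u in Ico (2*a) 1, g u / (u - a)| ≤ M / a * δ + 2 / δ * N := by
    set φ : ℝ → ℝ := fun u => indicator (Ioo 0 δ) (fun _ => M / a) u + 2 / δ * |g u| with hφ
    have hind : Integrable (indicator (Ioo 0 δ) (fun _ : ℝ => M / a)) volume :=
      (integrable_indicator_iff measurableSet_Ioo).2 (integrableOn_const (by simp))
    have hgn : IntegrableOn (fun u => 2 / δ * |g u|) (Ioo (0:ℝ) 1) := hg.abs.const_mul _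
    have hφi : IntegrableOn φ (Ioo (0:ℝ) 1) := hind.integrableOn.add hgn
    have hφ0 : ∀ u, 0 ≤ φ u := fun u =>
      add_nonneg (indicator_nonneg (fun _ _ => by positivity) u) (by positivity)
    have hsub : Ico (2*a) 1 ⊆ Ioo (0:ℝ) 1 := fun u hu => ⟨by linarith [hu.1], hu.2⟩
    calc |∫ u in Ico (2*a) 1, g u / (u - a)| ≤ ∫ u in Ico (2*a) 1, φ u := by
          rw [← Real.norm_eq_abs]
          refine norm_integral_le_of_norm_le (hφi.mono_set hsub) ?_
          refine (ae_restrict_iff' measurableSet_Ico).2 (Eventually.of_forall fun u hu => ?_)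
          have hua : a ≤ u - a := by linarith [hu.1]
          rw [norm_div, Real.norm_eq_abs, Real.norm_eq_abs, abs_of_pos (by linarith : 0 < u - a)]
          rcases lt_or_ge u δ with h | h
          · have hm : u ∈ Ioo 0 δ := ⟨by linarith, h⟩
            have : |g u| / (u - a) ≤ M / a := by
              gcongr
              exact hM u ⟨hm.1, by linarith⟩
            simp only [hφ, indicator_of_mem hm]
            have : 0 ≤ 2 / δ * |g u| := by positivity
            linarith
          · have hm : u ∉ Ioo 0 δ := fun h' => absurd h'.2 (not_lt.2 h)
            simp only [hφ, indicator_of_notMem hm, zero_add]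
            have hd : δ / 2 ≤ u - a := by linarith
            calc |g u| / (u - a) ≤ |g u| / (δ / 2) := by gcongr
              _ = 2 / δ * |g u| := by field_simp
      _ ≤ ∫ u in Ioo (0:ℝ) 1, φ u :=
          setIntegral_mono_set hφi (Eventually.of_forall hφ0) hsub.eventuallyLE
      _ = (∫ u in Ioo (0:ℝ) 1, indicator (Ioo 0 δ) (fun _ => M / a) u) + 2 / δ * N := by
          rw [hφ, integral_add hind.integrableOn hgn, integral_const_mul]
      _ ≤ M / a * δ + 2 / δ * N := by
          gcongr
          calc (∫ u in Ioo (0:ℝ) 1, indicator (Ioo 0 δ) (fun _ => M / a) u)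
              ≤ ∫ u, indicator (Ioo 0 δ) (fun _ => M / a) u :=
                setIntegral_le_integral hind (Eventually.of_forall fun u =>
                  indicator_nonneg (fun _ _ => by positivity) u)
            _ = M / a * δ := by
                rw [integral_indicator measurableSet_Ioo, setIntegral_const,
                  Real.volume_real_Ioo_of_le hδ0.le]
                simp [mul_comm]
  have h3 : K * (2 * a) + (M / a * δ + 2 / δ * N) ≤ B / a := by
    rw [le_div_iff₀ ha0]
    have e1 : (K * (2 * a) + (M / a * δ + 2 / δ * N)) * a =
        (2 * K * a + 2 / δ * N) * a + M * δ := by field_simp; ring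
    have e2 : 2 * K * a + 2 / δ * N ≤ C := by
      have : 2 * K * a ≤ 2 * K * 1 := by gcongr
      rw [hC]; linarith
    have e3 : (2 * K * a + 2 / δ * N) * a ≤ C * (B / 2 / C) := by gcongr
    have e4 : C * (B / 2 / C) = B / 2 := by field_simp
    linarith
  linarith [(abs_le.1 h1).1, (abs_le.1 h2).1]

theorem aux_strictMono (U : ℝ → ℝ) (hU : AdmissibleShearFlow U) : StrictMonoOn U (Ici 0) := by
  refine strictMonoOn_of_deriv_pos (convex_Ici 0) hU.smooth.continuous.continuousOn ?_
  intro x hx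
  rw [interior_Ici] at hx
  exact hU.deriv_pos x (le_of_lt hx)

theorem aux_inv (U : ℝ → ℝ) (hU : AdmissibleShearFlow U) (y : ℝ) (hy : 0 ≤ y) :
    shearInv U (U y) = y := by
  have h : ∃ x ∈ Ici (0:ℝ), U x = U y := ⟨y, hy, rfl⟩
  exact (aux_strictMono U hU).injOn (Function.invFunOn_mem h) hy (Function.invFunOn_eq h)

theorem aux_g (U : ℝ → ℝ) (hU : AdmissibleShearFlow U) (y : ℝ) (hy : 0 ≤ y) :
    gfun U (U y) = (1 - U y) ^ 2 * iteratedDeriv 2 U y / (deriv U y) ^ 3 := by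
  rw [gfun, aux_inv U hU y hy]

theorem aux_image (U : ℝ → ℝ) (hU : AdmissibleShearFlow U) : U '' Ioi 0 = Ioo 0 1 := by
  ext u
  constructor
  · rintro ⟨y, hy, rfl⟩
    refine ⟨?_, (hU.mem_Ico y (le_of_lt hy)).2⟩
    have := aux_strictMono U hU self_mem_Ici (le_of_lt hy : (0:ℝ) ≤ y) hy
    rwa [hU.zero_val] at this
  · rintro ⟨h0, h1⟩
    obtain ⟨z, hz, hz0⟩ := ((hU.tendsto_one.eventually (lt_mem_nhds h1)).and
      (eventually_ge_atTop 0)).exists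
    obtain ⟨y, hy, rfl⟩ := intermediate_value_Icc hz0 hU.smooth.continuous.continuousOn
      (show u ∈ Icc (U 0) (U z) from ⟨by rw [hU.zero_val]; exact h0.le, hz.le⟩)
    refine ⟨y, lt_of_le_of_ne hy.1 ?_, rfl⟩
    rintro rfl
    rw [hU.zero_val] at h0
    exact lt_irrefl _ h0

theorem aux_int (U : ℝ → ℝ) (hU : AdmissibleShearFlow U) : IntegrableOn (gfun U) (Ioo 0 1) := by
  have hd : Differentiable ℝ U := hU.smooth.differentiable (by simp)
  rw [← aux_image U hU, integrableOn_image_iff_integrableOn_abs_deriv_smul measurableSet_Ioi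
    (fun x _ => (hd x).hasDerivAt.hasDerivWithinAt)
    ((aux_strictMono U hU).injOn.mono Ioi_subset_Ici_self)]
  refine hU.decay_ratio₃.congr_fun ?_ measurableSet_Ioi
  intro y hy
  have h0 : (0:ℝ) ≤ y := le_of_lt hy
  have hp := hU.deriv_pos y h0
  simp only [aux_g U hU y h0, smul_eq_mul, abs_of_pos hp]
  field_simp

theorem aux_lip (U : ℝ → ℝ) (hU : AdmissibleShearFlow U) : ∃ K : ℝ, 0 ≤ K ∧
    ∀ u ∈ Ioo (0:ℝ) (U 1), ∀ v ∈ Ioo (0:ℝ) (U 1), |gfun U u - gfun U v| ≤ K * |u - v| := by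
  have hd : Differentiable ℝ U := hU.smooth.differentiable (by simp)
  have hs1 : ContDiff ℝ (⊤ : ℕ∞) (deriv U) := (contDiff_infty_iff_deriv.1 hU.smooth).2
  have hs2 : ContDiff ℝ (⊤ : ℕ∞) (iteratedDeriv 2 U) := by
    have : iteratedDeriv 2 U = deriv (deriv U) := by
      rw [iteratedDeriv_succ, iteratedDeriv_one]
    rw [this]
    exact (contDiff_infty_iff_deriv.1 hs1).2
  have hq : ContDiffOn ℝ (⊤ : ℕ∞)
      (fun y => (1 - U y) ^ 2 * iteratedDeriv 2 U y / (deriv U y) ^ 3) (Icc 0 1) := by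
    refine ContDiffOn.div ?_ ?_ ?_
    · exact (((contDiff_const.sub hU.smooth).pow 2).mul hs2).contDiffOn
    · exact (hs1.pow 3).contDiffOn
    · intro y hy
      exact pow_ne_zero _ (hU.deriv_pos y hy.1).ne'
  obtain ⟨Kq, hKq⟩ := hq.exists_lipschitzOnWith (by simp) (convex_Icc 0 1) isCompact_Icc
  obtain ⟨x0, hx0, hmin⟩ := isCompact_Icc.exists_isMinOn (nonempty_Icc.2 (zero_le_one' ℝ))
    (hs1.continuous.continuousOn (s := Icc (0:ℝ) 1))
  set m := deriv U x0 with hm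
  have hm0 : 0 < m := hU.deriv_pos x0 hx0.1
  have hexp : ∀ x ∈ Icc (0:ℝ) 1, ∀ y ∈ Icc (0:ℝ) 1, m * |x - y| ≤ |U x - U y| := by
    have base := (convex_Icc (0:ℝ) 1).mul_sub_le_image_sub_of_le_deriv (C := m)
      hd.continuous.continuousOn hd.differentiableOn
      (fun x hx => hmin (interior_subset hx))
    intro x hx y hy
    rcases le_total x y with h | h
    · rw [abs_sub_comm x, abs_sub_comm (U x), abs_of_nonneg (sub_nonneg.2 h)]
      exact (base x hx y hy h).trans (le_abs_self _)
    · rw [abs_of_nonneg (sub_nonneg.2 h)]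
      exact (base y hy x hx h).trans (le_abs_self _)
  have hsurj : ∀ u ∈ Ioo (0:ℝ) (U 1), ∃ y ∈ Icc (0:ℝ) 1, U y = u := by
    intro u hu
    exact intermediate_value_Icc zero_le_one hU.smooth.continuous.continuousOn
      (show u ∈ Icc (U 0) (U 1) from ⟨by rw [hU.zero_val]; exact hu.1.le, hu.2.le⟩)
  refine ⟨Kq / m, by positivity, ?_⟩
  intro u hu v hv
  obtain ⟨x, hx, rfl⟩ := hsurj u hu
  obtain ⟨y, hy, rfl⟩ := hsurj v hv
  rw [aux_g U hU x hx.1, aux_g U hU y hy.1]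
  have h1 := hKq.dist_le_mul x hx y hy
  rw [Real.dist_eq, Real.dist_eq] at h1
  have h2 : |x - y| ≤ |U x - U y| / m := by
    rw [le_div_iff₀ hm0, mul_comm]; exact hexp x hx y hy
  calc _ ≤ (Kq:ℝ) * |x - y| := h1
    _ ≤ Kq * (|U x - U y| / m) := by gcongr
    _ = _ := by ring

/-- Lemma (behavior of `G` near `0`: `Re G(a) ≥ c/a`). -/
theorem G_near_zero (U : ℝ → ℝ) (hU : AdmissibleShearFlow U) :
    ∃ c : ℝ, 0 < c ∧ ∃ ρ : ℝ, 0 < ρ ∧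
      ∀ a ∈ Ioc (0:ℝ) ρ, c / a ≤ (Gfun U a).re := by
  obtain ⟨K, hK0, hK⟩ := aux_lip U hU
  have hd0 := hU.deriv_pos 0 le_rfl
  have hr : 0 < U 1 := by
    have : U 1 ∈ Ioo (0:ℝ) 1 := aux_image U hU ▸ mem_image_of_mem U (by simp : (1:ℝ) ∈ Ioi 0)
    exact this.1
  have hr1 : U 1 < 1 := (hU.mem_Ico 1 zero_le_one).2
  set B := 1 / (2 * deriv U 0) with hB
  have hB0 : 0 < B := by positivity
  obtain ⟨ρ, hρ, h⟩ := aux_bound (gfun U) (aux_int U hU) K (U 1) hr hr1 hK hK0 B hB0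
  refine ⟨B, hB0, ρ, hρ, fun a ha => ?_⟩
  have h1 := h a ha
  have ha0 := ha.1
  have hre : (Gfun U a).re = 1 / (a * deriv U 0) + pvIntegral (gfun U) a := by
    unfold Gfun
    rw [Complex.add_re, Complex.ofReal_re, Complex.re_mul_ofReal]
    simp
  have h2 : 1 / (a * deriv U 0) = B / a + B / a := by
    rw [hB]; field_simp; norm_num
  rw [hre, h2]
  linarith

end
end
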